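/- For each integer s ≥ 4, the set 𝒟_s of curves of 𝒞^s having 0 as an endpoint covers the cube P_{0,2^{s−3}}. In particular, Ĉ is the union of 6 curves having 0 as an endpoint. -/

import Mathlib

namespace Folding

noncomputable section

open Set

/-- Points of `ℝ^n` with the euclidean distance. -/
abbrev Pt (n : ℕ) := EuclideanSpace ℝ (Fin n)

/-- `p` is a point of the lattice `ℤ^n`. -/
def latt {n : ℕ} (p : Pt n) : Prop := ∀ i, ∃ m : ℤ, p i = (m : ℝ)

/-- `p` belongs to `m·ℤ^n`. -/
def inLat {n : ℕ} (m : ℕ) (p : Pt n) : Prop := ∀ i, ∃ c : ℤ, p i = (m : ℝ) * (c : ℝ)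

/-- The canonical basis vector `e_i`. -/
def uvec (n : ℕ) (i : Fin n) : Pt n := EuclideanSpace.single i (1 : ℝ)

/-- `u` belongs to `E = {e_1, -e_1, …, e_n, -e_n}`. -/
def IsDir {n : ℕ} (u : Pt n) : Prop := ∃ i, u = uvec n i ∨ u = -uvec n i

/-- A (nonoriented) lattice segment `[x, x + e_i]`, as an unordered pair of endpoints. -/
def IsSeg {n : ℕ} (S : Sym2 (Pt n)) : Prop := ∃ x i, latt x ∧ S = s(x, x + uvec n i)

/-- A curve: a sequence of segments, indexed by an interval of `ℤ` (finite, ℕ-like or ℤ-like),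
recorded through its sequence of vertices; two consecutive segments have exactly one common
endpoint, and the common endpoints with the preceding and the following segments differ
(`noback`). -/
structure Curve (n : ℕ) where
  dom : Set ℤ
  ordConn : dom.OrdConnected
  nontriv : ∃ i, i ∈ dom ∧ i + 1 ∈ dom
  v : ℤ → Pt n
  lattice : ∀ i ∈ dom, latt (v i)
  step : ∀ i : ℤ, i ∈ dom → i + 1 ∈ dom →
    ∃ j, v (i + 1) = v i + uvec n j ∨ v (i + 1) = v i - uvec n j
  noback : ∀ i : ℤ, i - 1 ∈ dom → i + 1 ∈ dom → v (i + 1) ≠ v (i - 1)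

namespace Curve

variable {n : ℕ} (c : Curve n)

/-- The segments of a curve. -/
def segs : Set (Sym2 (Pt n)) :=
  {S | ∃ i : ℤ, i ∈ c.dom ∧ i + 1 ∈ c.dom ∧ S = s(c.v i, c.v (i + 1))}

/-- The connexions between segments of a curve: pairs of consecutive segments. -/
def conn (S T : Sym2 (Pt n)) : Prop :=
  ∃ i : ℤ, i - 1 ∈ c.dom ∧ i + 1 ∈ c.dom ∧
    ((S = s(c.v (i - 1), c.v i) ∧ T = s(c.v i, c.v (i + 1))) ∨
     (T = s(c.v (i - 1), c.v i) ∧ S = s(c.v i, c.v (i + 1))))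

/-- A curve is self-avoiding if each of its segments appears only once. -/
def SelfAvoiding : Prop :=
  ∀ i j : ℤ, i ∈ c.dom → i + 1 ∈ c.dom → j ∈ c.dom → j + 1 ∈ c.dom →
    s(c.v i, c.v (i + 1)) = s(c.v j, c.v (j + 1)) → i = j

/-- A curve without endpoints (indexed by `ℤ`). -/
def NoEndpts : Prop := c.dom = Set.univ

/-- `p` is an endpoint of the curve `c`. -/
def IsEndpt (p : Pt n) : Prop :=
  ∃ i ∈ c.dom, p = c.v i ∧ (i - 1 ∉ c.dom ∨ i + 1 ∉ c.dom)

/-- `S` is the end segment of `c` at its endpoint `p`. -/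
def endSegAt (p : Pt n) (S : Sym2 (Pt n)) : Prop :=
  ∃ i : ℤ, i ∈ c.dom ∧ p = c.v i ∧
    ((i - 1 ∉ c.dom ∧ i + 1 ∈ c.dom ∧ S = s(c.v i, c.v (i + 1))) ∨
     (i + 1 ∉ c.dom ∧ i - 1 ∈ c.dom ∧ S = s(c.v (i - 1), c.v i)))

/-- The number of segments (length) of a curve. -/
def nsegs : ℕ := {i : ℤ | i ∈ c.dom ∧ i + 1 ∈ c.dom}.ncard

end Curve

/-- The trace of a set of curves: its set of segments together with the connexion
relation between segments.  Two sets of curves are geometrically the same set of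
(nonoriented) curves iff they have the same trace. -/
structure Trace (n : ℕ) where
  segs : Set (Sym2 (Pt n))
  conn : Sym2 (Pt n) → Sym2 (Pt n) → Prop

def curveTrace {n : ℕ} (c : Curve n) : Trace n := ⟨c.segs, c.conn⟩

def traceOf {n : ℕ} (E : Set (Curve n)) : Trace n :=
  ⟨{S | ∃ c ∈ E, S ∈ c.segs}, fun S T => ∃ c ∈ E, c.conn S T⟩

/-- Two curves are the same nonoriented curve. -/
def SameCurve {n : ℕ} (c d : Curve n) : Prop := c.segs = d.segs ∧ c.conn = d.conn

/-- A set of pairwise disjoint self-avoiding curves. -/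
def DisjSA {n : ℕ} (E : Set (Curve n)) : Prop :=
  (∀ c ∈ E, c.SelfAvoiding) ∧
  ∀ c ∈ E, ∀ d ∈ E, ¬ SameCurve c d → ∀ S, S ∈ c.segs → S ∉ d.segs

/-- The set of points of `ℝ^n` lying on the segment `S`. -/
def segPts {n : ℕ} (S : Sym2 (Pt n)) : Set (Pt n) :=
  {p | ∃ a b, S = s(a, b) ∧ ∃ t : ℝ, 0 ≤ t ∧ t ≤ 1 ∧ p = a + t • (b - a)}

def Trace.pts {n : ℕ} (T : Trace n) : Set (Pt n) := ⋃ S ∈ T.segs, segPts S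

/-- A set of curves covers `X ⊆ ℝ^n`: each lattice segment containing a point of `X`
appears in one and only one of the curves. -/
def Covers {n : ℕ} (E : Set (Curve n)) (X : Set (Pt n)) : Prop :=
  ∀ S, IsSeg S → (segPts S ∩ X).Nonempty →
    (∃ c ∈ E, S ∈ c.segs) ∧ ∀ c ∈ E, ∀ d ∈ E, S ∈ c.segs → S ∈ d.segs → SameCurve c d

/-- A covering of `ℝ^n` by disjoint self-avoiding curves. -/
def IsCovering {n : ℕ} (E : Set (Curve n)) : Prop := DisjSA E ∧ Covers E Set.univ

/-- A single curve covers `X`. -/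
def CurveCovers {n : ℕ} (c : Curve n) (X : Set (Pt n)) : Prop :=
  ∀ S, IsSeg S → (segPts S ∩ X).Nonempty → S ∈ c.segs

/-- `b` is a curve contained in the curve `a`. -/
def SubCurve {n : ℕ} (b a : Curve n) : Prop :=
  b.segs ⊆ a.segs ∧ ∀ S T, b.conn S T → a.conn S T

/-- The relation `≺` at the level of traces. -/
def TPrec {n : ℕ} (T T' : Trace n) : Prop :=
  T.segs ⊆ T'.segs ∧ ∀ S S', T.conn S S' → T'.conn S S'

/-- `E ≺ F` : each segment of a curve of `E` is a segment of a curve of `F` and each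
connexion between two segments of a curve of `E` also exists in `F`. -/
def Prec {n : ℕ} (E F : Set (Curve n)) : Prop := TPrec (traceOf E) (traceOf F)

/-- Image of a trace under a map of `ℝ^n`. -/
def Trace.map {n : ℕ} (f : Pt n → Pt n) (T : Trace n) : Trace n :=
  ⟨Sym2.map f '' T.segs,
   fun S S' => ∃ A B, T.conn A B ∧ S = Sym2.map f A ∧ S' = Sym2.map f B⟩

/-- Translation of a trace by the vector `t`. -/
def Trace.transl {n : ℕ} (t : Pt n) (T : Trace n) : Trace n := T.map (fun p => p + t)

/-- Property (H) for the pair `(k, l)`. -/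
def SatH {n : ℕ} (A : Set (Curve n)) (k l : ℕ) : Prop :=
  0 < k ∧ 0 < l ∧ k ∣ l ∧ IsCovering A ∧
  (∀ c ∈ A, c.dom.Finite ∧ ∃ x i, latt x ∧ inLat k x ∧ c.IsEndpt x ∧
      c.IsEndpt (x + (k : ℝ) • uvec n i) ∧
      ∀ p, c.IsEndpt p → p = x ∨ p = x + (k : ℝ) • uvec n i) ∧
  (∀ (x : Pt n) (i : Fin n), latt x → inLat k x →
      (∃ c ∈ A, c.IsEndpt x ∧ c.IsEndpt (x + (k : ℝ) • uvec n i)) ∧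
      ∀ c ∈ A, ∀ d ∈ A, c.IsEndpt x → c.IsEndpt (x + (k : ℝ) • uvec n i) →
        d.IsEndpt x → d.IsEndpt (x + (k : ℝ) • uvec n i) → SameCurve c d) ∧
  (∀ t : Pt n, inLat l t → Trace.transl t (traceOf A) = traceOf A)

/-- The trace of the convolution product `A ∗ B`, where `A` satisfies (H) for `(k, l)`:
apply to `B` the homothety of center `0` and ratio `k`, then replace each resulting
segment by the curve of `A` having the same endpoints (connexions come from the curves
of `A`, together with the junctions of the end segments of consecutive `A`-curves). -/
def ConvTrace {n : ℕ} (k : ℕ) (A B : Set (Curve n)) : Trace n where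
  segs := {S | ∃ a b : Pt n, s(a, b) ∈ (traceOf B).segs ∧
    ∃ c ∈ A, c.IsEndpt ((k : ℝ) • a) ∧ c.IsEndpt ((k : ℝ) • b) ∧ S ∈ c.segs}
  conn := fun S S' =>
    (∃ a b : Pt n, s(a, b) ∈ (traceOf B).segs ∧
      ∃ c ∈ A, c.IsEndpt ((k : ℝ) • a) ∧ c.IsEndpt ((k : ℝ) • b) ∧ c.conn S S') ∨
    (∃ a b d : Pt n, (traceOf B).conn s(a, b) s(b, d) ∧
      ∃ c ∈ A, ∃ c' ∈ A, c.IsEndpt ((k : ℝ) • a) ∧ c.IsEndpt ((k : ℝ) • b) ∧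
        c'.IsEndpt ((k : ℝ) • b) ∧ c'.IsEndpt ((k : ℝ) • d) ∧
        ((c.endSegAt ((k : ℝ) • b) S ∧ c'.endSegAt ((k : ℝ) • b) S') ∨
         (c.endSegAt ((k : ℝ) • b) S' ∧ c'.endSegAt ((k : ℝ) • b) S)))

/-- The two-sided identity of the convolution product: the covering consisting of all
curves with one segment. -/
def unitTrace (n : ℕ) : Trace n := ⟨{S | IsSeg S}, fun _ _ => False⟩

/-- `P s` realizes the power `A^s` for the convolution product. -/
def PowersOf {n : ℕ} (A : Set (Curve n)) (k : ℕ) (P : ℕ → Set (Curve n)) : Prop :=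
  (∀ s, DisjSA (P s)) ∧ traceOf (P 0) = unitTrace n ∧
  ∀ s, traceOf (P (s + 1)) = ConvTrace k A (P s)

/-- The trace of `Â`, the inductive limit of the `A^s` for `≺`. -/
def hatTrace {n : ℕ} (P : ℕ → Set (Curve n)) : Trace n :=
  ⟨{S | ∃ s, S ∈ (traceOf (P s)).segs}, fun S T => ∃ s, (traceOf (P s)).conn S T⟩

/-- A pairing relation on `E = {e_1, -e_1, …, e_n, -e_n}`. -/
def IsPairing {n : ℕ} (R : Pt n → Pt n → Prop) : Prop :=
  (∀ u v, R u v → R v u) ∧ (∀ u v, R u v → IsDir u ∧ IsDir v) ∧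
  (∀ u, ¬ R u u) ∧ ∀ u, IsDir u → ∃! v, R u v

/-- The trace of `Â_R` : `Â` with the segments with endpoint `0` connected according
to `R`. -/
def hatRTrace {n : ℕ} (P : ℕ → Set (Curve n)) (R : Pt n → Pt n → Prop) : Trace n :=
  ⟨(hatTrace P).segs,
   fun S T => (hatTrace P).conn S T ∨
     ∃ u v, R u v ∧ S = s((0 : Pt n), u) ∧ T = s((0 : Pt n), v)⟩

/-- The cube `P_{x,h}`. -/
def cube {n : ℕ} (x : Pt n) (h : ℕ) : Set (Pt n) :=
  {p | ∀ i, x i - h ≤ p i ∧ p i ≤ x i + h}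

/-- Restriction of a trace to a region `X` of `ℝ^n`. -/
def Trace.restr {n : ℕ} (T : Trace n) (X : Set (Pt n)) : Trace n :=
  ⟨{S | S ∈ T.segs ∧ segPts S ⊆ X},
   fun S S' => T.conn S S' ∧ segPts S ⊆ X ∧ segPts S' ⊆ X⟩

/-- Condition (C). -/
def CondC {n : ℕ} (T : Trace n) : Prop :=
  ∀ (x : Pt n) (h : ℕ), latt x → 1 ≤ h →
    ∃ y : Pt n, latt y ∧ y ∉ cube x h ∧
      Trace.transl (y - x) (T.restr (cube x h)) = T.restr (cube y h)

/-- `(B(x,r) ∩ T, x) ≅ (B(y,r) ∩ T', y)` : the translation sending `x` to `y` maps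
the part of `T` in the closed ball `B(x,r)` onto the part of `T'` in `B(y,r)`,
preserving the connexions between segments. -/
def BallIso {n : ℕ} (T : Trace n) (x : Pt n) (T' : Trace n) (y : Pt n) (r : ℝ) : Prop :=
  (fun p => p + (y - x)) '' (T.pts ∩ Metric.closedBall x r) =
      T'.pts ∩ Metric.closedBall y r ∧
  (∀ S S', T.conn S S' → segPts S ⊆ Metric.closedBall x r →
      segPts S' ⊆ Metric.closedBall x r →
      T'.conn (Sym2.map (fun p => p + (y - x)) S) (Sym2.map (fun p => p + (y - x)) S')) ∧
  (∀ S S', T'.conn S S' → segPts S ⊆ Metric.closedBall y r →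
      segPts S' ⊆ Metric.closedBall y r →
      T.conn (Sym2.map (fun p => p + (x - y)) S) (Sym2.map (fun p => p + (x - y)) S'))

/-- The local isomorphism property. -/
def LocIsoProp {n : ℕ} (T : Trace n) : Prop :=
  ∀ (x : Pt n) (r : ℝ), 0 ≤ r →
    ∃ t : ℝ, 0 ≤ t ∧ ∀ y : Pt n, ∃ z ∈ Metric.closedBall y t, BallIso T x T z r

/-- Two traces are locally isomorphic. -/
def LocallyIso {n : ℕ} (T T' : Trace n) : Prop :=
  (∀ (x : Pt n) (r : ℝ), 0 ≤ r → ∃ y, BallIso T x T' y r) ∧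
  (∀ (y : Pt n) (r : ℝ), 0 ≤ r → ∃ x, BallIso T' y T x r)

/-- `Ω_{s,x}` : suppress the connexions between segments whose common endpoint lies in
`x + k^s ℤ^n`. -/
def OmegaTrace {n : ℕ} (k s : ℕ) (x : Pt n) (T : Trace n) : Trace n :=
  ⟨T.segs, fun S S' => T.conn S S' ∧ ¬ ∃ p, p ∈ S ∧ p ∈ S' ∧ inLat (k ^ s) (p - x)⟩

/-- `Σ_{s,x}(E)` : for each curve `D` of `E` passing through `x`, the curve(s) with
endpoint `x` contained in `D` having maximal length, this length being limited to
`8^s`. -/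
def SigmaSet {n : ℕ} (s : ℕ) (x : Pt n) (E : Set (Curve n)) : Set (Curve n) :=
  {b | ∃ D ∈ E, SubCurve b D ∧ b.IsEndpt x ∧ b.nsegs ≤ 8 ^ s ∧
    ∀ b' : Curve n, SubCurve b' D → b'.IsEndpt x → b'.nsegs ≤ 8 ^ s →
      SubCurve b b' → SameCurve b b'}

/-- A positive (orientation preserving) isometry of `ℝ^n`. -/
def PosIsom {n : ℕ} (f : Pt n → Pt n) : Prop :=
  ∃ (g : Pt n ≃ₗᵢ[ℝ] Pt n) (t : Pt n), (∀ x, f x = g x + t) ∧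
    0 < LinearMap.det (g.toLinearEquiv.toLinearMap)

/-- `E` consists of exactly `m` curves. -/
def HasExactly {n : ℕ} (E : Set (Curve n)) (m : ℕ) : Prop :=
  ∃ L : List (Curve n), L.length = m ∧ (∀ c ∈ L, c ∈ E) ∧
    L.Pairwise (fun c d => ¬ SameCurve c d) ∧ ∀ c ∈ E, ∃ d ∈ L, SameCurve c d

/-- `E` consists of at most `m` curves. -/
def AtMost {n : ℕ} (E : Set (Curve n)) (m : ℕ) : Prop :=
  ∃ L : List (Curve n), L.length ≤ m ∧ ∀ c ∈ E, ∃ d ∈ L, SameCurve c d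

/-- The set of points of a curve. -/
def curvePts {n : ℕ} (c : Curve n) : Set (Pt n) := ⋃ S ∈ c.segs, segPts S

-- ℝ³-specific part
def toPt3 (f : Fin 3 → ℝ) : Pt 3 := (WithLp.equiv 2 (Fin 3 → ℝ)).symm f

def p3 (a b c : ℤ) : Pt 3 := toPt3 ![(a : ℝ), (b : ℝ), (c : ℝ)]

/-- The vertices of the curve `C`. -/
def CList : List (Pt 3) :=
  [p3 0 0 0, p3 0 (-1) 0, p3 0 (-1) (-1), p3 0 0 (-1), p3 1 0 (-1),
   p3 1 (-1) (-1), p3 1 (-1) 0, p3 1 0 0, p3 2 0 0]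

/-- The block `ℬ₀` : six curves given by their lists of successive vertices. -/
def B0 : List (List (Pt 3)) :=
  [ CList,
    [p3 0 0 0, p3 0 0 1, p3 0 1 1, p3 0 1 0, p3 (-1) 1 0, p3 (-1) 1 1,
     p3 (-1) 0 1, p3 (-1) 0 0, p3 (-2) 0 0],
    [p3 0 0 0, p3 0 0 (-1), p3 (-1) 0 (-1), p3 (-1) 0 0, p3 (-1) 1 0,
     p3 (-1) 1 (-1), p3 0 1 (-1), p3 0 1 0, p3 0 2 0],
    [p3 0 0 0, p3 1 0 0, p3 1 0 1, p3 0 0 1, p3 0 (-1) 1, p3 1 (-1) 1,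
     p3 1 (-1) 0, p3 0 (-1) 0, p3 0 (-2) 0],
    [p3 0 0 0, p3 (-1) 0 0, p3 (-1) (-1) 0, p3 0 (-1) 0, p3 0 (-1) 1,
     p3 (-1) (-1) 1, p3 (-1) 0 1, p3 0 0 1, p3 0 0 2],
    [p3 0 0 0, p3 0 1 0, p3 1 1 0, p3 1 0 0, p3 1 0 (-1), p3 1 1 (-1),
     p3 0 1 (-1), p3 0 0 (-1), p3 0 0 (-2)] ]

def sigma3 : Pt 3 → Pt 3 := fun x => toPt3 ![x 0, -(x 1), -(x 2)]
def tau3 : Pt 3 → Pt 3 := fun x => toPt3 ![x 0, x 2, -(x 1)]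
def ups3 : Pt 3 → Pt 3 := fun x => toPt3 ![x 0, -(x 2), x 1]

/-- The four blocks `ℬ₀, ℬ₁, ℬ₂, ℬ₃`. -/
def blockLists : Fin 4 → List (List (Pt 3)) :=
  ![B0,
    B0.map (List.map fun p => p3 2 2 0 + sigma3 p),
    B0.map (List.map fun p => p3 2 0 2 + tau3 p),
    B0.map (List.map fun p => p3 0 2 2 + ups3 p)]

def listSegs (L : List (Pt 3)) : Set (Sym2 (Pt 3)) :=
  {S | ∃ j : ℕ, j + 1 < L.length ∧ S = s(L.getD j 0, L.getD (j + 1) 0)}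

def listConn (L : List (Pt 3)) (S T : Sym2 (Pt 3)) : Prop :=
  ∃ j : ℕ, j + 2 < L.length ∧
    ((S = s(L.getD j 0, L.getD (j + 1) 0) ∧ T = s(L.getD (j + 1) 0, L.getD (j + 2) 0)) ∨
     (T = s(L.getD j 0, L.getD (j + 1) 0) ∧ S = s(L.getD (j + 1) 0, L.getD (j + 2) 0)))

/-- The trace of the curve given by a list of successive vertices. -/
def listTrace (L : List (Pt 3)) : Trace 3 := ⟨listSegs L, listConn L⟩

/-- The trace of the covering `𝒞 = ⋃_{u ∈ ℤ³, 0 ≤ i ≤ 3} (4u + ℬ_i)`. -/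
def CTrace : Trace 3 where
  segs := {S | ∃ u : Pt 3, latt u ∧ ∃ (i : Fin 4), ∃ M ∈ blockLists i,
    S ∈ (Trace.transl ((4 : ℝ) • u) (listTrace M)).segs}
  conn := fun S T => ∃ u : Pt 3, latt u ∧ ∃ (i : Fin 4), ∃ M ∈ blockLists i,
    (Trace.transl ((4 : ℝ) • u) (listTrace M)).conn S T

open Classical in
/-- The permutation `θ` of `E` with `θ(e₁) = -e₂`, `θ(e₂) = -e₃`, `θ(e₃) = -e₁`
and `θ² = Id`. -/
def theta3 : Pt 3 → Pt 3 := fun u =>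
  if u = uvec 3 0 then -uvec 3 1
  else if u = -uvec 3 1 then uvec 3 0
  else if u = uvec 3 1 then -uvec 3 2
  else if u = -uvec 3 2 then uvec 3 1
  else if u = uvec 3 2 then -uvec 3 0
  else if u = -uvec 3 0 then uvec 3 2
  else u

/-- `R^θ`. -/
def Rtheta (R : Pt 3 → Pt 3 → Prop) : Pt 3 → Pt 3 → Prop :=
  fun u v => R (theta3 u) (theta3 v)

def Rx (P : ℕ → Set (Curve 3)) (x : Pt 3) : Pt 3 → Pt 3 → Prop :=
  fun u v => (hatTrace P).conn s(x, x + u) s(x, x + v)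

/-- Condition (P). -/
def SatP (P : ℕ → Set (Curve 3)) (R : Pt 3 → Pt 3 → Prop) : Prop :=
  ∃ x : Pt 3, (∀ i, x i = -2 ∨ x i = 0 ∨ x i = 2 ∨ x i = 4) ∧
    (¬ ∀ i, x i = 0 ∨ x i = 4) ∧ (Rx P x = R ∨ Rx P x = Rtheta R)

/-- The trace of `Ĉ_X`, the inductive limit of the sets `x_s + 𝒞^s`. -/
def hatXTrace (P : ℕ → Set (Curve 3)) (x : ℕ → Pt 3) : Trace 3 :=
  ⟨{S | ∃ s, 1 ≤ s ∧ S ∈ (Trace.transl (x s) (traceOf (P s))).segs},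
   fun S T => ∃ s, 1 ≤ s ∧ (Trace.transl (x s) (traceOf (P s))).conn S T⟩

/-- The curve `c` is equivalent to `C` (image of `C` by a positive isometry). -/
def EquivToC (c : Curve 3) : Prop :=
  ∃ f, PosIsom f ∧ curveTrace c = Trace.map f (listTrace CList)

/-- `x` is an endpoint of type `0` (resp. `1`) of the curve `c`, for `c`
equivalent to `C`. -/
def EndptType (c : Curve 3) (x : Pt 3) (ty : ℕ) : Prop :=
  ∃ f, PosIsom f ∧ curveTrace c = Trace.map f (listTrace CList) ∧
    x = f (if ty = 0 then p3 0 0 0 else p3 2 0 0)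

namespace Curve

variable {n : ℕ} {c : Curve n} {S T : Sym2 (Pt n)} {p : Pt n}

theorem conn_symm (h : c.conn S T) : c.conn T S := by
  obtain ⟨i, h1, h2, h⟩ := h
  exact ⟨i, h1, h2, h.symm⟩

theorem mem_dom_of_mem_Icc {i j k : ℤ} (hi : i ∈ c.dom) (hk : k ∈ c.dom) (hij : i ≤ j)
    (hjk : j ≤ k) : j ∈ c.dom :=
  c.ordConn.out hi hk ⟨hij, hjk⟩

theorem exists_of_conn (h : c.conn S T) :
    ∃ a b d, S = s(a, b) ∧ T = s(b, d) ∧ S ∈ c.segs ∧ T ∈ c.segs := by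
  obtain ⟨i, h1, h2, h⟩ := h
  have h0 : i ∈ c.dom := mem_dom_of_mem_Icc h1 h2 (by lia) (by lia)
  have hl : s(c.v (i - 1), c.v i) ∈ c.segs :=
    ⟨i - 1, h1, by simpa using h0, by simp⟩
  have hr : s(c.v i, c.v (i + 1)) ∈ c.segs := ⟨i, h0, h2, rfl⟩
  rcases h with ⟨rfl, rfl⟩ | ⟨rfl, rfl⟩
  · exact ⟨_, _, _, rfl, rfl, hl, hr⟩
  · exact ⟨_, _, _, Sym2.eq_swap, Sym2.eq_swap, hr, hl⟩

theorem left_mem_segs_of_conn (h : c.conn S T) : S ∈ c.segs := by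
  obtain ⟨_, _, _, _, _, h, _⟩ := exists_of_conn h
  exact h

theorem right_mem_segs_of_conn (h : c.conn S T) : T ∈ c.segs :=
  left_mem_segs_of_conn (conn_symm h)

theorem isSeg_of_mem_segs (h : S ∈ c.segs) : IsSeg S := by
  obtain ⟨i, h1, h2, rfl⟩ := h
  obtain ⟨j, h | h⟩ := c.step i h1 h2
  · exact ⟨c.v i, j, c.lattice i h1, by rw [h]⟩
  · exact ⟨c.v (i + 1), j, c.lattice _ h2, by rw [h, Sym2.eq_swap]; simp⟩

/-- A curve containing a segment at `p` but no connexion at `p` has `p` as an endpoint. -/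
theorem isEndpt_of_forall_not_conn (hS : S ∈ c.segs) (hp : p ∈ S)
    (h : ∀ T T', c.conn T T' → ¬ (p ∈ T ∧ p ∈ T')) : c.IsEndpt p := by
  obtain ⟨i, h1, h2, rfl⟩ := hS
  rcases Sym2.mem_iff.1 hp with rfl | rfl
  · refine ⟨i, h1, rfl, Or.inl fun h0 => ?_⟩
    exact h _ _ ⟨i, h0, h2, Or.inl ⟨rfl, rfl⟩⟩ (by simp)
  · refine ⟨i + 1, h2, rfl, Or.inr fun h0 => ?_⟩
    exact h _ _ ⟨i + 1, by simpa using h1, h0, Or.inl ⟨rfl, rfl⟩⟩ (by simp)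

theorem reflTransGen_conn (hS : S ∈ c.segs) (hT : T ∈ c.segs) :
    Relation.ReflTransGen c.conn S T := by
  have key : ∀ i j : ℤ, i ≤ j → i ∈ c.dom → j + 1 ∈ c.dom →
      Relation.ReflTransGen c.conn s(c.v i, c.v (i + 1)) s(c.v j, c.v (j + 1)) := by
    intro i j hij hi
    induction j, hij using Int.leInduction with
    | base => intro _; exact .refl
    | succ j hij ih =>
      intro hj
      have hj' : j + 1 ∈ c.dom := mem_dom_of_mem_Icc hi hj (by lia) (by lia)
      have hj'' : j ∈ c.dom := mem_dom_of_mem_Icc hi hj (by lia) (by lia)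
      exact (ih hj').tail ⟨j + 1, by simpa using hj'', hj, Or.inl (by simp)⟩
  obtain ⟨i, h1, h2, rfl⟩ := hS
  obtain ⟨j, h3, h4, rfl⟩ := hT
  rcases le_total i j with hij | hij
  · exact key i j hij h1 h4
  · have : Std.Symm c.conn := ⟨fun _ _ h => conn_symm h⟩
    exact Relation.ReflTransGen.stdSymm.symm _ _ (key j i hij h3 h2)

theorem exists_endSegAt (h : c.IsEndpt p) : ∃ S, c.endSegAt p S := by
  obtain ⟨i, hi, rfl, h⟩ := h
  obtain ⟨j, hj, hj'⟩ := c.nontriv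
  rcases h with h | h
  · have hij : i ≤ j := by
      by_contra hlt
      exact h (mem_dom_of_mem_Icc hj hi (by lia) (by lia))
    exact ⟨_, i, hi, rfl, Or.inl ⟨h, mem_dom_of_mem_Icc hi hj' (by lia) (by lia), rfl⟩⟩
  · have hij : j + 1 ≤ i := by
      by_contra hlt
      exact h (mem_dom_of_mem_Icc hi hj' (by lia) (by lia))
    exact ⟨_, i, hi, rfl, Or.inr ⟨h, mem_dom_of_mem_Icc hj hi (by lia) (by lia), rfl⟩⟩

theorem mem_segs_of_endSegAt (h : c.endSegAt p S) : S ∈ c.segs := by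
  obtain ⟨i, hi, _, ⟨_, h, rfl⟩ | ⟨_, h, rfl⟩⟩ := h
  · exact ⟨i, hi, h, rfl⟩
  · exact ⟨i - 1, h, by simpa using hi, by simp⟩

theorem mem_of_endSegAt (h : c.endSegAt p S) : p ∈ S := by
  obtain ⟨i, hi, rfl, ⟨_, h, rfl⟩ | ⟨_, h, rfl⟩⟩ := h <;> simp

/-- The curve `c` read from its `i`-th vertex on, forwards if `ε = 1` and backwards if
`ε = -1`. -/
def reindex (c : Curve n) (i ε : ℤ) (hε : ε = 1 ∨ ε = -1) : Curve n where
  dom := {j | i + ε * j ∈ c.dom}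
  ordConn := by
    refine ⟨fun x hx y hy z hz => ?_⟩
    rcases hε with rfl | rfl
    · exact mem_dom_of_mem_Icc hx hy (by have := hz.1; lia) (by have := hz.2; lia)
    · exact mem_dom_of_mem_Icc hy hx (by have := hz.2; lia) (by have := hz.1; lia)
  nontriv := by
    obtain ⟨j, hj, hj'⟩ := c.nontriv
    rcases hε with rfl | rfl
    · refine ⟨j - i, ?_, ?_⟩
      · rwa [mem_ofPred_eq, show i + 1 * (j - i) = j by ring]
      · rwa [mem_ofPred_eq, show i + 1 * (j - i + 1) = j + 1 by ring]
    · refine ⟨i - j - 1, ?_, ?_⟩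
      · rwa [mem_ofPred_eq, show i + -1 * (i - j - 1) = j + 1 by ring]
      · rwa [mem_ofPred_eq, show i + -1 * (i - j - 1 + 1) = j by ring]
  v := fun j => c.v (i + ε * j)
  lattice := fun j hj => c.lattice _ hj
  step := by
    intro j hj hj'
    rcases hε with rfl | rfl
    · have := c.step (i + 1 * j) hj (by simpa [add_assoc] using hj')
      simpa [add_assoc] using this
    · have e : i + -1 * (j + 1) + 1 = i + -1 * j := by ring
      obtain ⟨k, h⟩ := c.step (i + -1 * (j + 1)) hj' (by rw [e]; exact hj)
      rw [e] at h
      refine ⟨k, ?_⟩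
      rcases h with h | h
      · right; rw [h]; simp
      · left; rw [h]; simp
  noback := by
    intro j hj hj'
    rcases hε with rfl | rfl
    · rw [mem_ofPred_eq, show i + 1 * (j - 1) = i + j - 1 by ring] at hj
      rw [mem_ofPred_eq, show i + 1 * (j + 1) = i + j + 1 by ring] at hj'
      rw [show i + 1 * (j + 1) = i + j + 1 by ring, show i + 1 * (j - 1) = i + j - 1 by ring]
      exact c.noback _ hj hj'
    · rw [mem_ofPred_eq, show i + -1 * (j - 1) = i - j + 1 by ring] at hj
      rw [mem_ofPred_eq, show i + -1 * (j + 1) = i - j - 1 by ring] at hj'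
      rw [show i + -1 * (j + 1) = i - j - 1 by ring, show i + -1 * (j - 1) = i - j + 1 by ring]
      exact (c.noback _ hj' hj).symm

end Curve

section Trace

variable {n : ℕ} {E : Set (Curve n)} {c d : Curve n} {S T : Sym2 (Pt n)}

theorem isSeg_of_mem_segs_traceOf (h : S ∈ (traceOf E).segs) : IsSeg S := by
  obtain ⟨c, _, h⟩ := h
  exact Curve.isSeg_of_mem_segs h

theorem mem_segs_of_conn_traceOf (h : (traceOf E).conn S T) :
    S ∈ (traceOf E).segs ∧ T ∈ (traceOf E).segs := by
  obtain ⟨c, hc, h⟩ := h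
  exact ⟨⟨c, hc, Curve.left_mem_segs_of_conn h⟩, ⟨c, hc, Curve.right_mem_segs_of_conn h⟩⟩

theorem DisjSA.sameCurve (hE : DisjSA E) (hc : c ∈ E) (hd : d ∈ E) (hS : S ∈ c.segs)
    (hS' : S ∈ d.segs) : SameCurve c d := by
  by_contra h
  exact hE.2 c hc d hd h S hS hS'

theorem DisjSA.conn_of_conn (hE : DisjSA E) (hc : c ∈ E) (hS : S ∈ c.segs)
    (h : (traceOf E).conn S T) : c.conn S T := by
  obtain ⟨d, hd, h⟩ := h
  rw [(hE.sameCurve hc hd hS (Curve.left_mem_segs_of_conn h)).2]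
  exact h

theorem DisjSA.mem_segs_of_reflTransGen (hE : DisjSA E) (hc : c ∈ E) (hS : S ∈ c.segs)
    (h : Relation.ReflTransGen (traceOf E).conn S T) : T ∈ c.segs := by
  induction h with
  | refl => exact hS
  | tail _ h ih => exact Curve.right_mem_segs_of_conn (hE.conn_of_conn hc ih h)

/-- The trace `T` has no connexion at the point `p`. -/
def NoConnAt (T : Trace n) (p : Pt n) : Prop := ∀ S S', T.conn S S' → ¬ (p ∈ S ∧ p ∈ S')

theorem NoConnAt.isEndpt {p : Pt n} (h : NoConnAt (traceOf E) p) (hc : c ∈ E)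
    (hS : S ∈ c.segs) (hp : p ∈ S) : c.IsEndpt p :=
  Curve.isEndpt_of_forall_not_conn hS hp fun T T' hT => h T T' ⟨c, hc, hT⟩

theorem isSeg_zero_left (hS : IsSeg S) (h : (0 : Pt n) ∈ S) :
    ∃ u, IsDir u ∧ S = s(0, u) := by
  obtain ⟨x, i, _, rfl⟩ := hS
  rcases Sym2.mem_iff.1 h with h | h
  · subst h
    exact ⟨uvec n i, ⟨i, Or.inl rfl⟩, by simp⟩
  · obtain rfl : x = -uvec n i := (neg_eq_of_add_eq_zero_left h.symm).symm
    exact ⟨-uvec n i, ⟨i, Or.inr rfl⟩, by simp [Sym2.eq_swap]⟩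

theorem isSeg_zero_isDir {u : Pt n} (hu : IsDir u) : IsSeg s(0, u) := by
  obtain ⟨i, rfl | rfl⟩ := hu
  · exact ⟨0, i, fun _ => ⟨0, by simp⟩, by simp⟩
  · refine ⟨-uvec n i, i, fun j => ?_, by simp [Sym2.eq_swap]⟩
    by_cases h : j = i
    · subst h
      exact ⟨-1, by simp [uvec]⟩
    · exact ⟨0, by simp [uvec, h]⟩

theorem IsSeg.latt_right {a b : Pt n} (h : IsSeg s(a, b)) : latt b := by
  obtain ⟨x, i, hx, h⟩ := h
  have hx' : latt (x + uvec n i) := by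
    intro j
    obtain ⟨m, hm⟩ := hx j
    by_cases hij : j = i
    · subst hij
      exact ⟨m + 1, by simp [uvec, hm]⟩
    · exact ⟨m, by simp [uvec, hm, hij]⟩
  rcases Sym2.eq_iff.1 h with ⟨-, rfl⟩ | ⟨-, rfl⟩
  · exact hx'
  · exact hx

theorem not_isSeg_zero_two_smul {b : Pt n} (hb : latt b) : ¬ IsSeg s(0, (2 : ℝ) • b) := by
  intro h
  obtain ⟨u, ⟨i, hu⟩, h⟩ := isSeg_zero_left h (by simp)
  obtain ⟨m, hm⟩ := hb i
  have h1 : (2 : ℝ) • b = u := by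
    rcases Sym2.eq_iff.1 h with ⟨-, h⟩ | ⟨h, h'⟩
    · exact h
    · rw [h', h]
  have h2 : (2 : ℝ) * m = u i := by rw [← h1, ← hm]; simp
  rcases hu with rfl | rfl
  · have h3 : (2 : ℝ) * m = 1 := by simpa [uvec] using h2
    have : 2 * m = 1 := by exact_mod_cast h3
    lia
  · have h3 : (2 : ℝ) * m = -1 := by simpa [uvec] using h2
    have : 2 * m = -1 := by exact_mod_cast h3
    lia

end Trace

section Limit

variable {n : ℕ}

/-- The curve `c` starts at `0` along the segment `[0, u]`. -/
structure StartsAlong (u : Pt n) (c : Curve n) : Prop where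
  selfAvoiding : c.SelfAvoiding
  neg_one_notMem : -1 ∉ c.dom
  zero_mem : 0 ∈ c.dom
  one_mem : 1 ∈ c.dom
  v_zero : c.v 0 = 0
  v_one : c.v 1 = u

theorem StartsAlong.nonneg {u : Pt n} {c : Curve n} (hc : StartsAlong u c) {i : ℤ}
    (hi : i ∈ c.dom) : 0 ≤ i := by
  by_contra h
  exact hc.neg_one_notMem (Curve.mem_dom_of_mem_Icc hi hc.zero_mem (by lia) (by lia))

theorem StartsAlong.isEndpt {u : Pt n} {c : Curve n} (hc : StartsAlong u c) : c.IsEndpt 0 :=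
  ⟨0, hc.zero_mem, hc.v_zero.symm, Or.inl (by simpa using hc.neg_one_notMem)⟩

theorem StartsAlong.mem_segs {u : Pt n} {c : Curve n} (hc : StartsAlong u c) :
    s(0, u) ∈ c.segs :=
  ⟨0, hc.zero_mem, by simpa using hc.one_mem, by simp [hc.v_zero, hc.v_one]⟩

theorem Curve.sameCurve_reindex (c : Curve n) (i ε : ℤ) (hε : ε = 1 ∨ ε = -1) :
    SameCurve (c.reindex i ε hε) c := by
  constructor
  · ext S
    constructor
    · rintro ⟨j, hj, hj', rfl⟩
      rcases hε with rfl | rfl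
      · refine ⟨i + 1 * j, hj, ?_, ?_⟩
        · have h1 : i + 1 * (j + 1) ∈ c.dom := hj'
          rwa [show i + 1 * (j + 1) = i + 1 * j + 1 by ring] at h1
        · simp [reindex, add_assoc]
      · refine ⟨i + -1 * (j + 1), hj', ?_, ?_⟩
        · rwa [show i + -1 * (j + 1) + 1 = i + -1 * j by ring]
        · rw [show i + -1 * (j + 1) + 1 = i + -1 * j by ring, Sym2.eq_swap]
          rfl
    · rintro ⟨j, hj, hj', rfl⟩
      rcases hε with rfl | rfl
      · refine ⟨j - i, ?_, ?_, ?_⟩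
        · rwa [reindex, mem_ofPred_eq, show i + 1 * (j - i) = j by ring]
        · rwa [reindex, mem_ofPred_eq, show i + 1 * (j - i + 1) = j + 1 by ring]
        · simp only [reindex]
          rw [show i + 1 * (j - i) = j by ring, show i + 1 * (j - i + 1) = j + 1 by ring]
      · refine ⟨i - j - 1, ?_, ?_, ?_⟩
        · rwa [reindex, mem_ofPred_eq, show i + -1 * (i - j - 1) = j + 1 by ring]
        · rwa [reindex, mem_ofPred_eq, show i + -1 * (i - j - 1 + 1) = j by ring]
        · simp only [reindex]
          rw [show i + -1 * (i - j - 1) = j + 1 by ring,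
            show i + -1 * (i - j - 1 + 1) = j by ring, Sym2.eq_swap]
  · ext S T
    constructor
    · rintro ⟨j, hj, hj', h⟩
      simp only [reindex, mem_ofPred_eq] at hj hj' h
      rcases hε with rfl | rfl
      · rw [show i + 1 * (j - 1) = i + j - 1 by ring] at hj h
        rw [show i + 1 * (j + 1) = i + j + 1 by ring] at hj' h
        rw [one_mul] at h
        exact ⟨i + j, hj, hj', h⟩
      · rw [show i + -1 * (j - 1) = i - j + 1 by ring] at hj h
        rw [show i + -1 * (j + 1) = i - j - 1 by ring] at hj' h
        rw [show i + -1 * j = i - j by ring] at h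
        refine ⟨i - j, hj', hj, ?_⟩
        rw [Sym2.eq_swap (a := c.v (i - j - 1)), Sym2.eq_swap (b := c.v (i - j + 1))]
        tauto
    · rintro ⟨j, hj, hj', h⟩
      rcases hε with rfl | rfl
      · refine ⟨j - i, ?_, ?_, ?_⟩
        · rwa [reindex, mem_ofPred_eq, show i + 1 * (j - i - 1) = j - 1 by ring]
        · rwa [reindex, mem_ofPred_eq, show i + 1 * (j - i + 1) = j + 1 by ring]
        · simp only [reindex]
          rw [show i + 1 * (j - i - 1) = j - 1 by ring, show i + 1 * (j - i) = j by ring,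
            show i + 1 * (j - i + 1) = j + 1 by ring]
          exact h
      · refine ⟨i - j, ?_, ?_, ?_⟩
        · rwa [reindex, mem_ofPred_eq, show i + -1 * (i - j - 1) = j + 1 by ring]
        · rwa [reindex, mem_ofPred_eq, show i + -1 * (i - j + 1) = j - 1 by ring]
        · simp only [reindex]
          rw [show i + -1 * (i - j - 1) = j + 1 by ring, show i + -1 * (i - j) = j by ring,
            show i + -1 * (i - j + 1) = j - 1 by ring,
            Sym2.eq_swap (a := c.v (j + 1)), Sym2.eq_swap (b := c.v (j - 1))]
          tauto

theorem Curve.SelfAvoiding.reindex {c : Curve n} (hc : c.SelfAvoiding) (i ε : ℤ)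
    (hε : ε = 1 ∨ ε = -1) : (c.reindex i ε hε).SelfAvoiding := by
  intro j k hj hj' hk hk' h
  simp only [Curve.reindex, mem_ofPred_eq] at hj hj' hk hk' h
  rcases hε with rfl | rfl
  · have := hc (i + 1 * j) (i + 1 * k) hj (by rwa [show i + 1 * j + 1 = i + 1 * (j + 1) by ring])
      hk (by rwa [show i + 1 * k + 1 = i + 1 * (k + 1) by ring]) (by
        rw [show i + 1 * j + 1 = i + 1 * (j + 1) by ring,
          show i + 1 * k + 1 = i + 1 * (k + 1) by ring]
        exact h)
    lia
  · have := hc (i + -1 * (j + 1)) (i + -1 * (k + 1)) hj'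
      (by rwa [show i + -1 * (j + 1) + 1 = i + -1 * j by ring])
      hk' (by rwa [show i + -1 * (k + 1) + 1 = i + -1 * k by ring]) (by
        rw [show i + -1 * (j + 1) + 1 = i + -1 * j by ring,
          show i + -1 * (k + 1) + 1 = i + -1 * k by ring, Sym2.eq_swap,
          Sym2.eq_swap (b := c.v (i + -1 * k))]
        exact h)
    lia

/-- A self-avoiding curve containing `[0, u]` and no connexion at `0` can be described
as starting at `0` along `[0, u]`. -/
theorem exists_startsAlong {u : Pt n} {c : Curve n} (hc : c.SelfAvoiding)
    (hu : s(0, u) ∈ c.segs) (h0 : ∀ S T, c.conn S T → ¬ (0 ∈ S ∧ 0 ∈ T)) :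
    ∃ d, SameCurve d c ∧ StartsAlong u d := by
  obtain ⟨i, hi, hi', h⟩ := hu
  rcases Sym2.eq_iff.1 h with ⟨h1, h2⟩ | ⟨h1, h2⟩
  · refine ⟨c.reindex i 1 (Or.inl rfl), c.sameCurve_reindex _ _ _, hc.reindex _ _ _, ?_, ?_, ?_,
      ?_, ?_⟩
    · intro hm
      have hm' : i - 1 ∈ c.dom := by simpa [Curve.reindex, ← sub_eq_add_neg] using hm
      exact h0 _ _ ⟨i, hm', hi', Or.inl ⟨rfl, rfl⟩⟩ (by simp [← h1])
    · simpa [Curve.reindex] using hi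
    · simpa [Curve.reindex] using hi'
    · simp [Curve.reindex, h1]
    · simp [Curve.reindex, h2]
  · refine ⟨c.reindex (i + 1) (-1) (Or.inr rfl), c.sameCurve_reindex _ _ _,
      hc.reindex _ _ _, ?_, ?_, ?_, ?_, ?_⟩
    · intro hm
      have hm' : i + 1 + 1 ∈ c.dom := by simpa [Curve.reindex] using hm
      exact h0 _ _ ⟨i + 1, by simpa using hi, hm', Or.inl ⟨rfl, rfl⟩⟩ (by simp [← h1])
    · simpa [Curve.reindex] using hi'
    · simpa [Curve.reindex] using hi
    · simp [Curve.reindex, h1]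
    · simp [Curve.reindex, h2]

theorem StartsAlong.subCurve_prefix {u : Pt n} {c d : Curve n} (hc : StartsAlong u c)
    (hd : StartsAlong u d) (h : SubCurve c d) {i : ℤ} (hi : i ∈ c.dom) :
    i ∈ d.dom ∧ d.v i = c.v i := by
  obtain ⟨m, rfl⟩ := Int.eq_ofNat_of_zero_le (hc.nonneg hi)
  induction m using Nat.strong_induction_on with
  | _ m ih =>
    match m with
    | 0 => exact ⟨hd.zero_mem, by simp [hd.v_zero, hc.v_zero]⟩
    | 1 => exact ⟨by simpa using hd.one_mem, by simp [hd.v_one, hc.v_one]⟩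
    | m + 2 =>
      have hi0 : (m : ℤ) ∈ c.dom :=
        Curve.mem_dom_of_mem_Icc hc.zero_mem hi (by lia) (by lia)
      have hi1 : (m : ℤ) + 1 ∈ c.dom :=
        Curve.mem_dom_of_mem_Icc hc.zero_mem hi (by lia) (by lia)
      have hi2 : (m : ℤ) + 1 + 1 ∈ c.dom := by
        rwa [show (m : ℤ) + 1 + 1 = (m + 2 : ℕ) by push_cast; ring]
      obtain ⟨a0, b0⟩ := ih m (by lia) hi0
      obtain ⟨a1, b1⟩ := ih (m + 1) (by lia) (by simpa using hi1)
      push_cast at a1 b1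
      rw [show ((m + 2 : ℕ) : ℤ) = (m : ℤ) + 1 + 1 by push_cast; ring]
      obtain ⟨k, hk, hk', h | h⟩ := h.2 s(c.v m, c.v (m + 1)) s(c.v (m + 1), c.v (m + 1 + 1))
        ⟨m + 1, by simpa using hi0, hi2, Or.inl (by simp)⟩
      · have hk0 : k ∈ d.dom := Curve.mem_dom_of_mem_Icc hk hk' (by lia) (by lia)
        have e : (m : ℤ) = k - 1 := hd.selfAvoiding _ _ a0 a1 hk (by simpa using hk0)
          (by rw [b0, b1, h.1]; simp)
        obtain rfl : k = m + 1 := by lia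
        refine ⟨hk', ?_⟩
        have h2 := h.2
        rw [b1] at h2
        exact (Sym2.congr_right.1 h2).symm
      · have hk0 : k ∈ d.dom := Curve.mem_dom_of_mem_Icc hk hk' (by lia) (by lia)
        have e : (m : ℤ) = k := hd.selfAvoiding _ _ a0 a1 hk0 hk' (by rw [b0, b1, h.2])
        subst e
        have hm := hd.nonneg hk
        obtain ⟨l, rfl⟩ : ∃ l, m = l + 1 := ⟨m - 1, by lia⟩
        have hl : (l : ℤ) ∈ c.dom :=
          Curve.mem_dom_of_mem_Icc hc.zero_mem hi (by lia) (by lia)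
        obtain ⟨a2, b2⟩ := ih l (by lia) hl
        push_cast at *
        have := hc.selfAvoiding _ _ hi1 hi2 hl hi0 (by
          rw [h.1, b0]; simp [b2])
        lia

/-- The union of a sequence of curves each of which extends the preceding ones. -/
theorem exists_limit_curve (c : ℕ → Curve n)
    (h : ∀ s t, s ≤ t → ∀ i ∈ (c s).dom, i ∈ (c t).dom ∧ (c t).v i = (c s).v i) :
    ∃ d : Curve n, (∀ i, i ∈ d.dom ↔ ∃ s, i ∈ (c s).dom) ∧
      (∀ s, ∀ i ∈ (c s).dom, d.v i = (c s).v i) ∧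
      (∀ S, S ∈ d.segs ↔ ∃ s, S ∈ (c s).segs) ∧
      ∀ S T, d.conn S T ↔ ∃ s, (c s).conn S T := by
  classical
  set v : ℤ → Pt n := fun i =>
    if hi : ∃ s, i ∈ (c s).dom then (c hi.choose).v i else 0 with hv
  have hv' : ∀ s, ∀ i ∈ (c s).dom, v i = (c s).v i := by
    intro s i hi
    have hex : ∃ s, i ∈ (c s).dom := ⟨s, hi⟩
    simp only [hv, dif_pos hex]
    rcases le_total s hex.choose with hs | hs
    · exact (h _ _ hs i hi).2
    · exact (h _ _ hs i hex.choose_spec).2.symm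
  have hjoin : ∀ i j, (∃ s, i ∈ (c s).dom) → (∃ s, j ∈ (c s).dom) →
      ∃ s, i ∈ (c s).dom ∧ j ∈ (c s).dom := by
    rintro i j ⟨s, hs⟩ ⟨t, ht⟩
    exact ⟨max s t, (h _ _ (le_max_left _ _) i hs).1, (h _ _ (le_max_right _ _) j ht).1⟩
  let d : Curve n :=
    { dom := {i | ∃ s, i ∈ (c s).dom}
      ordConn := by
        refine ⟨fun x hx y hy z hz => ?_⟩
        obtain ⟨s, hs, hs'⟩ := hjoin x y hx hy
        exact ⟨s, Curve.mem_dom_of_mem_Icc hs hs' hz.1 hz.2⟩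
      nontriv := by
        obtain ⟨i, hi, hi'⟩ := (c 0).nontriv
        exact ⟨i, ⟨0, hi⟩, ⟨0, hi'⟩⟩
      v := v
      lattice := by
        rintro i ⟨s, hs⟩
        rw [hv' s i hs]
        exact (c s).lattice i hs
      step := by
        intro i hi hi'
        obtain ⟨s, hs, hs'⟩ := hjoin _ _ hi hi'
        rw [hv' s _ hs, hv' s _ hs']
        exact (c s).step i hs hs'
      noback := by
        intro i hi hi'
        obtain ⟨s, hs, hs'⟩ := hjoin _ _ hi hi'
        rw [hv' s _ hs, hv' s _ hs']
        exact (c s).noback i hs hs' }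
  refine ⟨d, fun i => Iff.rfl, hv', fun S => ⟨?_, ?_⟩, fun S T => ⟨?_, ?_⟩⟩
  · rintro ⟨i, hi, hi', rfl⟩
    obtain ⟨s, hs, hs'⟩ := hjoin _ _ hi hi'
    exact ⟨s, i, hs, hs', by rw [← hv' s _ hs, ← hv' s _ hs']⟩
  · rintro ⟨s, i, hs, hs', rfl⟩
    exact ⟨i, ⟨s, hs⟩, ⟨s, hs'⟩, by rw [← hv' s _ hs, ← hv' s _ hs']⟩
  · rintro ⟨i, hi, hi', hST⟩
    obtain ⟨s, hs, hs'⟩ := hjoin _ _ hi hi'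
    have hs0 : i ∈ (c s).dom :=
      Curve.mem_dom_of_mem_Icc hs hs' (sub_le_self _ zero_le_one)
        (le_add_of_nonneg_right zero_le_one)
    refine ⟨s, i, hs, hs', ?_⟩
    rwa [← hv' s _ hs, ← hv' s _ hs', ← hv' s _ hs0]
  · rintro ⟨s, i, hs, hs', hST⟩
    have hs0 : i ∈ (c s).dom :=
      Curve.mem_dom_of_mem_Icc hs hs' (sub_le_self _ zero_le_one)
        (le_add_of_nonneg_right zero_le_one)
    refine ⟨i, ⟨s, hs⟩, ⟨s, hs'⟩, ?_⟩
    rwa [← hv' s _ hs, ← hv' s _ hs', ← hv' s _ hs0] at hST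

end Limit

section Block

/-- The lattice point of `ℝ³` with given integer coordinates. -/
def ofInt (a : ℤ × ℤ × ℤ) : Pt 3 := p3 a.1 a.2.1 a.2.2

@[simp] theorem ofInt_apply_zero (a : ℤ × ℤ × ℤ) : ofInt a 0 = a.1 := rfl
@[simp] theorem ofInt_apply_one (a : ℤ × ℤ × ℤ) : ofInt a 1 = a.2.1 := rfl
@[simp] theorem ofInt_apply_two (a : ℤ × ℤ × ℤ) : ofInt a 2 = a.2.2 := rfl

theorem ofInt_injective : Function.Injective ofInt := by
  intro a b h
  have h0 := congrArg (fun p : Pt 3 => p 0) h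
  have h1 := congrArg (fun p : Pt 3 => p 1) h
  have h2 := congrArg (fun p : Pt 3 => p 2) h
  simp only [ofInt_apply_zero, ofInt_apply_one, ofInt_apply_two, Int.cast_inj] at h0 h1 h2
  exact Prod.ext h0 (Prod.ext h1 h2)

theorem ofInt_zero : ofInt 0 = 0 := by
  ext i; fin_cases i <;> simp

theorem ofInt_add (a b : ℤ × ℤ × ℤ) : ofInt (a + b) = ofInt a + ofInt b := by
  ext i; fin_cases i <;> simp

theorem ofInt_smul (k : ℤ) (a : ℤ × ℤ × ℤ) : ofInt (k • a) = (k : ℝ) • ofInt a := by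
  ext i; fin_cases i <;> simp

theorem latt_ofInt (a : ℤ × ℤ × ℤ) : latt (ofInt a) := by
  intro i; fin_cases i
  exacts [⟨a.1, rfl⟩, ⟨a.2.1, rfl⟩, ⟨a.2.2, rfl⟩]

theorem exists_ofInt_of_latt {p : Pt 3} (h : latt p) : ∃ a, p = ofInt a := by
  obtain ⟨x, hx⟩ := h 0
  obtain ⟨y, hy⟩ := h 1
  obtain ⟨z, hz⟩ := h 2
  refine ⟨(x, y, z), ?_⟩
  ext i; fin_cases i <;> simpa

/-- Integer coordinates of the vectors of the canonical basis. -/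
def basisInt : Fin 3 → ℤ × ℤ × ℤ := ![(1, 0, 0), (0, 1, 0), (0, 0, 1)]

theorem ofInt_basisInt (i : Fin 3) : ofInt (basisInt i) = uvec 3 i := by
  ext j; fin_cases i <;> fin_cases j <;> simp [basisInt, uvec]

theorem exists_ofInt_of_isSeg {S : Sym2 (Pt 3)} (h : IsSeg S) :
    ∃ a i, S = s(ofInt a, ofInt (a + basisInt i)) := by
  obtain ⟨x, i, hx, rfl⟩ := h
  obtain ⟨a, rfl⟩ := exists_ofInt_of_latt hx
  exact ⟨a, i, by rw [ofInt_add, ofInt_basisInt]⟩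

theorem isSeg_ofInt {a b : ℤ × ℤ × ℤ} (h : ∃ i, b = a + basisInt i ∨ a = b + basisInt i) :
    IsSeg s(ofInt a, ofInt b) := by
  obtain ⟨i, rfl | rfl⟩ := h
  · exact ⟨ofInt a, i, latt_ofInt a, by rw [ofInt_add, ofInt_basisInt]⟩
  · exact ⟨ofInt b, i, latt_ofInt b, by rw [ofInt_add, ofInt_basisInt, Sym2.eq_swap]⟩

/-- Integer coordinates of the vertices of the curves of `ℬ₀`. -/
def blockInt₀ : List (List (ℤ × ℤ × ℤ)) :=
  [ [(0, 0, 0), (0, -1, 0), (0, -1, -1), (0, 0, -1), (1, 0, -1),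
     (1, -1, -1), (1, -1, 0), (1, 0, 0), (2, 0, 0)],
    [(0, 0, 0), (0, 0, 1), (0, 1, 1), (0, 1, 0), (-1, 1, 0), (-1, 1, 1),
     (-1, 0, 1), (-1, 0, 0), (-2, 0, 0)],
    [(0, 0, 0), (0, 0, -1), (-1, 0, -1), (-1, 0, 0), (-1, 1, 0),
     (-1, 1, -1), (0, 1, -1), (0, 1, 0), (0, 2, 0)],
    [(0, 0, 0), (1, 0, 0), (1, 0, 1), (0, 0, 1), (0, -1, 1), (1, -1, 1),
     (1, -1, 0), (0, -1, 0), (0, -2, 0)],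
    [(0, 0, 0), (-1, 0, 0), (-1, -1, 0), (0, -1, 0), (0, -1, 1),
     (-1, -1, 1), (-1, 0, 1), (0, 0, 1), (0, 0, 2)],
    [(0, 0, 0), (0, 1, 0), (1, 1, 0), (1, 0, 0), (1, 0, -1), (1, 1, -1),
     (0, 1, -1), (0, 0, -1), (0, 0, -2)] ]

/-- Integer coordinates of the vertices of the curves of the blocks `ℬ₀, …, ℬ₃`. -/
def blockInt : Fin 4 → List (List (ℤ × ℤ × ℤ)) :=
  ![blockInt₀,
    blockInt₀.map (List.map fun a => (2 + a.1, 2 - a.2.1, -a.2.2)),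
    blockInt₀.map (List.map fun a => (2 + a.1, a.2.2, 2 - a.2.1)),
    blockInt₀.map (List.map fun a => (a.1, 2 - a.2.2, 2 + a.2.1))]

theorem B0_eq : B0 = blockInt₀.map (List.map ofInt) := rfl

theorem blockLists_eq (i : Fin 4) : blockLists i = (blockInt i).map (List.map ofInt) := by
  have key : ∀ (f : Pt 3 → Pt 3) (g : ℤ × ℤ × ℤ → ℤ × ℤ × ℤ), (∀ a, f (ofInt a) = ofInt (g a)) →
      B0.map (List.map f) = (blockInt₀.map (List.map g)).map (List.map ofInt) := by
    intro f g h
    rw [B0_eq, List.map_map, List.map_map]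
    refine List.map_congr_left fun m _ => ?_
    simp [Function.comp_def, h]
  fin_cases i
  · exact B0_eq
  · refine key _ _ fun a => ?_
    ext j; fin_cases j <;> simp [sigma3, toPt3, p3, ofInt, sub_eq_add_neg]
  · refine key _ _ fun a => ?_
    ext j; fin_cases j <;> simp [tau3, toPt3, p3, ofInt, sub_eq_add_neg]
  · refine key _ _ fun a => ?_
    ext j; fin_cases j <;> simp [ups3, toPt3, p3, ofInt, sub_eq_add_neg]

/-- The `j`-th vertex of the translate by `4u` of the curve with list of vertices `m`. -/
def vertex (u : ℤ × ℤ × ℤ) (m : List (ℤ × ℤ × ℤ)) (j : ℕ) : ℤ × ℤ × ℤ :=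
  (4 : ℤ) • u + m.getD j 0

theorem ofInt_vertex (u : ℤ × ℤ × ℤ) (m : List (ℤ × ℤ × ℤ)) (j : ℕ) :
    ofInt (vertex u m j) = (m.map ofInt).getD j 0 + (4 : ℝ) • ofInt u := by
  rw [vertex, ofInt_add, ofInt_smul, ← ofInt_zero, List.getD_map, add_comm]
  norm_num

/-- Half of the `j`-th vertex of the translate by `4u` of the curve `m`. -/
def halfVertex (u : ℤ × ℤ × ℤ) (m : List (ℤ × ℤ × ℤ)) (j : ℕ) : ℤ × ℤ × ℤ :=
  let a := m.getD j 0
  (2 : ℤ) • u + (a.1 / 2, a.2.1 / 2, a.2.2 / 2)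

theorem length_of_mem_blockInt : ∀ i, ∀ m ∈ blockInt i, m.length = 9 := by decide +kernel

theorem getD_succ_ne : ∀ i, ∀ m ∈ blockInt i, ∀ j < 7, m.getD j 0 ≠ m.getD (j + 2) 0 := by
  decide +kernel

theorem not_even_getD_succ : ∀ i, ∀ m ∈ blockInt i, ∀ j < 7,
    ¬ ((m.getD (j + 1) 0).1 % 2 = 0 ∧ (m.getD (j + 1) 0).2.1 % 2 = 0 ∧
      (m.getD (j + 1) 0).2.2 % 2 = 0) := by
  decide +kernel

theorem even_getD_endpoints : ∀ i, ∀ m ∈ blockInt i, ∀ j ∈ [0, 8],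
    (m.getD j 0).1 % 2 = 0 ∧ (m.getD j 0).2.1 % 2 = 0 ∧ (m.getD j 0).2.2 % 2 = 0 := by
  decide +kernel

theorem halfVertex_zero_adj : ∀ i, ∀ m ∈ blockInt i, ∃ k,
    halfVertex 0 m 8 = halfVertex 0 m 0 + basisInt k ∨
      halfVertex 0 m 0 = halfVertex 0 m 8 + basisInt k := by
  decide +kernel

/-- The interval spanned by `c` and `d` is at distance at most `1` from that spanned by
`a` and `b`. -/
def Close (a b c d : ℤ) : Prop := min a b - 1 ≤ min c d ∧ max c d ≤ max a b + 1

instance (a b c d : ℤ) : Decidable (Close a b c d) := inferInstanceAs (Decidable (_ ∧ _))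

theorem close_getD : ∀ i, ∀ m ∈ blockInt i, ∀ j < 8,
    Close (m.getD 0 0).1 (m.getD 8 0).1 (m.getD j 0).1 (m.getD (j + 1) 0).1 ∧
    Close (m.getD 0 0).2.1 (m.getD 8 0).2.1 (m.getD j 0).2.1 (m.getD (j + 1) 0).2.1 ∧
    Close (m.getD 0 0).2.2 (m.getD 8 0).2.2 (m.getD j 0).2.2 (m.getD (j + 1) 0).2.2 := by
  decide +kernel

theorem two_smul_halfVertex {i : Fin 4} {m : List (ℤ × ℤ × ℤ)} (hm : m ∈ blockInt i)
    (u : ℤ × ℤ × ℤ) {j : ℕ} (hj : j ∈ [0, 8]) :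
    (2 : ℤ) • halfVertex u m j = vertex u m j := by
  obtain ⟨h1, h2, h3⟩ := even_getD_endpoints i m hm j hj
  refine Prod.ext ?_ (Prod.ext ?_ ?_) <;>
    simp only [halfVertex, vertex, Prod.smul_fst, Prod.smul_snd, Prod.fst_add, Prod.snd_add,
      smul_eq_mul] <;>
    lia

theorem two_smul_ofInt_halfVertex {i : Fin 4} {m : List (ℤ × ℤ × ℤ)} (hm : m ∈ blockInt i)
    (u : ℤ × ℤ × ℤ) {j : ℕ} (hj : j ∈ [0, 8]) :
    (2 : ℝ) • ofInt (halfVertex u m j) = ofInt (vertex u m j) := by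
  rw [← two_smul_halfVertex hm u hj, ofInt_smul]
  norm_num

theorem isSeg_halfVertex {i : Fin 4} {m : List (ℤ × ℤ × ℤ)} (hm : m ∈ blockInt i)
    (u : ℤ × ℤ × ℤ) : IsSeg s(ofInt (halfVertex u m 0), ofInt (halfVertex u m 8)) := by
  have e : ∀ j, halfVertex u m j = (2 : ℤ) • u + halfVertex 0 m j := by
    intro j; simp [halfVertex]
  obtain ⟨k, h⟩ := halfVertex_zero_adj i m hm
  refine isSeg_ofInt ⟨k, ?_⟩
  rw [e, e]
  rcases h with h | h
  · left; rw [h, add_assoc]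
  · right; rw [h, add_assoc]

/-- The segment with endpoints `a` and `b` touches the cube `P_{0,h}`. -/
def Near (h : ℤ) (a b : ℤ × ℤ × ℤ) : Prop :=
  (-h ≤ max a.1 b.1 ∧ min a.1 b.1 ≤ h) ∧ (-h ≤ max a.2.1 b.2.1 ∧ min a.2.1 b.2.1 ≤ h) ∧
    (-h ≤ max a.2.2 b.2.2 ∧ min a.2.2 b.2.2 ≤ h)

instance (h : ℤ) (a b : ℤ × ℤ × ℤ) : Decidable (Near h a b) :=
  inferInstanceAs (Decidable (_ ∧ _ ∧ _))

theorem Near.symm {h : ℤ} {a b : ℤ × ℤ × ℤ} (hn : Near h a b) : Near h b a := by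
  unfold Near at *
  rw [max_comm b.1, min_comm b.1, max_comm b.2.1, min_comm b.2.1, max_comm b.2.2, min_comm b.2.2]
  exact hn

theorem near_halfVertex {i : Fin 4} {m : List (ℤ × ℤ × ℤ)} (hm : m ∈ blockInt i)
    {u : ℤ × ℤ × ℤ} {j : ℕ} (hj : j < 8) {h : ℤ}
    (hn : Near (2 * h) (vertex u m j) (vertex u m (j + 1))) :
    Near h (halfVertex u m 0) (halfVertex u m 8) := by
  have e0 := two_smul_halfVertex hm u (j := 0) (by simp)
  have e8 := two_smul_halfVertex hm u (j := 8) (by simp)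
  have aux : ∀ u a b c d a' b' : ℤ, Close a b c d → 2 * a' = 4 * u + a → 2 * b' = 4 * u + b →
      -(2 * h) ≤ max (4 * u + c) (4 * u + d) ∧ min (4 * u + c) (4 * u + d) ≤ 2 * h →
      -h ≤ max a' b' ∧ min a' b' ≤ h := by
    unfold Close
    intros
    lia
  obtain ⟨c1, c2, c3⟩ := close_getD i m hm j hj
  obtain ⟨n1, n2, n3⟩ := hn
  exact ⟨aux _ _ _ _ _ _ _ c1 (congrArg (·.1) e0) (congrArg (·.1) e8) n1,
    aux _ _ _ _ _ _ _ c2 (congrArg (·.2.1) e0) (congrArg (·.2.1) e8) n2,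
    aux _ _ _ _ _ _ _ c3 (congrArg (·.2.2) e0) (congrArg (·.2.2) e8) n3⟩

theorem mem_segs_CTrace {S : Sym2 (Pt 3)} : S ∈ CTrace.segs ↔ ∃ u i, ∃ m ∈ blockInt i,
    ∃ j < 8, S = s(ofInt (vertex u m j), ofInt (vertex u m (j + 1))) := by
  constructor
  · rintro ⟨u, hu, i, M, hM, A, ⟨j, hj, rfl⟩, rfl⟩
    obtain ⟨u, rfl⟩ := exists_ofInt_of_latt hu
    rw [blockLists_eq] at hM
    obtain ⟨m, hm, rfl⟩ := List.mem_map.1 hM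
    rw [List.length_map, length_of_mem_blockInt i m hm] at hj
    exact ⟨u, i, m, hm, j, by lia, by rw [ofInt_vertex, ofInt_vertex]; rfl⟩
  · rintro ⟨u, i, m, hm, j, hj, rfl⟩
    refine ⟨ofInt u, latt_ofInt u, i, m.map ofInt, ?_, _, ⟨j, ?_, rfl⟩, ?_⟩
    · rw [blockLists_eq]
      exact List.mem_map_of_mem hm
    · rw [List.length_map, length_of_mem_blockInt i m hm]
      lia
    · rw [ofInt_vertex, ofInt_vertex]; rfl

theorem conn_CTrace {S T : Sym2 (Pt 3)} : CTrace.conn S T ↔ ∃ u i, ∃ m ∈ blockInt i,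
    ∃ j < 7, (S = s(ofInt (vertex u m j), ofInt (vertex u m (j + 1))) ∧
        T = s(ofInt (vertex u m (j + 1)), ofInt (vertex u m (j + 2)))) ∨
      (T = s(ofInt (vertex u m j), ofInt (vertex u m (j + 1))) ∧
        S = s(ofInt (vertex u m (j + 1)), ofInt (vertex u m (j + 2)))) := by
  constructor
  · rintro ⟨u, hu, i, M, hM, A, B, ⟨j, hj, h⟩, rfl, rfl⟩
    obtain ⟨u, rfl⟩ := exists_ofInt_of_latt hu
    rw [blockLists_eq] at hM
    obtain ⟨m, hm, rfl⟩ := List.mem_map.1 hM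
    rw [List.length_map, length_of_mem_blockInt i m hm] at hj
    refine ⟨u, i, m, hm, j, by lia, ?_⟩
    rw [ofInt_vertex, ofInt_vertex, ofInt_vertex]
    rcases h with ⟨rfl, rfl⟩ | ⟨rfl, rfl⟩
    · exact Or.inl ⟨rfl, rfl⟩
    · exact Or.inr ⟨rfl, rfl⟩
  · rintro ⟨u, i, m, hm, j, hj, h⟩
    have hmem : m.map ofInt ∈ blockLists i := by
      rw [blockLists_eq]
      exact List.mem_map_of_mem hm
    have hlen : j + 2 < (m.map ofInt).length := by
      rw [List.length_map, length_of_mem_blockInt i m hm]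
      lia
    rw [ofInt_vertex, ofInt_vertex, ofInt_vertex] at h
    rcases h with ⟨rfl, rfl⟩ | ⟨rfl, rfl⟩
    · exact ⟨ofInt u, latt_ofInt u, i, _, hmem, _, _, ⟨j, hlen, Or.inl ⟨rfl, rfl⟩⟩, rfl, rfl⟩
    · exact ⟨ofInt u, latt_ofInt u, i, _, hmem, _, _, ⟨j, hlen, Or.inr ⟨rfl, rfl⟩⟩, rfl, rfl⟩

theorem noConnAt_CTrace (a : ℤ × ℤ × ℤ) : NoConnAt CTrace (ofInt ((2 : ℤ) • a)) := by
  have key : ∀ u i, ∀ m ∈ blockInt i, ∀ j < 7,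
      ofInt ((2 : ℤ) • a) ∈ s(ofInt (vertex u m j), ofInt (vertex u m (j + 1))) →
      ofInt ((2 : ℤ) • a) ∉ s(ofInt (vertex u m (j + 1)), ofInt (vertex u m (j + 2))) := by
    intro u i m hm j hj h1 h2
    simp only [Sym2.mem_iff, ofInt_injective.eq_iff] at h1 h2
    have hodd : (2 : ℤ) • a ≠ vertex u m (j + 1) := by
      intro h
      have e1 := congrArg (·.1) h
      have e2 := congrArg (·.2.1) h
      have e3 := congrArg (·.2.2) h
      simp only [vertex, Prod.smul_fst, Prod.smul_snd, Prod.fst_add, Prod.snd_add,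
        smul_eq_mul] at e1 e2 e3
      exact not_even_getD_succ i m hm j hj ⟨by lia, by lia, by lia⟩
    have e : vertex u m j = vertex u m (j + 2) :=
      (h1.resolve_right hodd).symm.trans (h2.resolve_left hodd)
    exact getD_succ_ne i m hm j hj (add_left_cancel e)
  rintro S T h ⟨hS, hT⟩
  obtain ⟨u, i, m, hm, j, hj, ⟨rfl, rfl⟩ | ⟨rfl, rfl⟩⟩ := conn_CTrace.1 h
  · exact key u i m hm j hj hS hT
  · exact key u i m hm j hj hT hS

/-- Does the segment with endpoints `a` and `b` belong to the `s`-th subdivision of a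
segment at `0`? -/
def reaches : ℕ → ℤ × ℤ × ℤ → ℤ × ℤ × ℤ → Bool
  | 0, a, b => decide (a = 0) || decide (b = 0)
  | s + 1, a, b =>
    (List.finRange 4).any fun i => (blockInt i).any fun m => (List.range 8).any fun j =>
      let p := m.getD j 0
      let q := m.getD (j + 1) 0
      let u := ((a.1 - p.1) / 4, (a.2.1 - p.2.1) / 4, (a.2.2 - p.2.2) / 4)
      let w := ((b.1 - p.1) / 4, (b.2.1 - p.2.1) / 4, (b.2.2 - p.2.2) / 4)
      (decide ((4 : ℤ) • u + p = a) && decide ((4 : ℤ) • u + q = b) &&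
        reaches s (halfVertex u m 0) (halfVertex u m 8)) ||
      (decide ((4 : ℤ) • w + p = b) && decide ((4 : ℤ) • w + q = a) &&
        reaches s (halfVertex w m 0) (halfVertex w m 8))

theorem reaches_three_of_near_one : ∀ x ∈ [-2, -1, 0, 1], ∀ y ∈ [-2, -1, 0, 1],
    ∀ z ∈ [-2, -1, 0, 1], ∀ k : Fin 3, Near 1 (x, y, z) ((x, y, z) + basisInt k) →
      reaches 3 (x, y, z) ((x, y, z) + basisInt k) = true := by
  decide +kernel

end Block

section Powers

variable {C3 : Set (Curve 3)} {P : ℕ → Set (Curve 3)} {S T : Sym2 (Pt 3)}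

theorem SatH.disjSA {k l : ℕ} (hH : SatH C3 k l) : DisjSA C3 := hH.2.2.2.1.1

theorem SatH.exists_mem_segs {k l : ℕ} (hH : SatH C3 k l) (hS : IsSeg S) :
    S ∈ (traceOf C3).segs := by
  refine (hH.2.2.2.1.2 S hS ?_).1
  obtain ⟨x, i, _, rfl⟩ := hS
  exact ⟨x, ⟨x, x + uvec 3 i, rfl, 0, le_rfl, zero_le_one, by simp⟩, mem_univ _⟩

/-- The segment `S` belongs to the curve of `C3` which subdivides the double of the segment
`T`. -/
def Subdivides (C3 : Set (Curve 3)) (S T : Sym2 (Pt 3)) : Prop :=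
  ∃ a b, T = s(a, b) ∧ ∃ c ∈ C3, c.IsEndpt ((2 : ℝ) • a) ∧ c.IsEndpt ((2 : ℝ) • b) ∧ S ∈ c.segs

theorem exists_curve_of_block (hC3 : traceOf C3 = CTrace) (hH : SatH C3 2 4) {i : Fin 4}
    {m : List (ℤ × ℤ × ℤ)} (hm : m ∈ blockInt i) (u : ℤ × ℤ × ℤ) :
    ∃ c ∈ C3, c.IsEndpt (ofInt (vertex u m 0)) ∧ c.IsEndpt (ofInt (vertex u m 8)) ∧
      ∀ j < 8, s(ofInt (vertex u m j), ofInt (vertex u m (j + 1))) ∈ c.segs := by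
  obtain ⟨c, hc, h0⟩ : s(ofInt (vertex u m 0), ofInt (vertex u m 1)) ∈ (traceOf C3).segs := by
    rw [hC3, mem_segs_CTrace]
    exact ⟨u, i, m, hm, 0, by lia, rfl⟩
  have hseg : ∀ j < 8, s(ofInt (vertex u m j), ofInt (vertex u m (j + 1))) ∈ c.segs := by
    intro j
    induction j with
    | zero => exact fun _ => h0
    | succ j ih =>
      intro hj
      have hconn : (traceOf C3).conn s(ofInt (vertex u m j), ofInt (vertex u m (j + 1)))
          s(ofInt (vertex u m (j + 1)), ofInt (vertex u m (j + 2))) := by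
        rw [hC3, conn_CTrace]
        exact ⟨u, i, m, hm, j, by lia, Or.inl ⟨rfl, rfl⟩⟩
      exact Curve.right_mem_segs_of_conn (hH.disjSA.conn_of_conn hc (ih (by lia)) hconn)
  refine ⟨c, hc, NoConnAt.isEndpt ?_ hc h0 (by simp),
    NoConnAt.isEndpt ?_ hc (hseg 7 (by lia)) (by simp), hseg⟩
  · rw [hC3, ← two_smul_halfVertex hm u (by simp)]
    exact noConnAt_CTrace _
  · rw [hC3, ← two_smul_halfVertex hm u (by simp)]
    exact noConnAt_CTrace _

theorem subdivides_of_block (hC3 : traceOf C3 = CTrace) (hH : SatH C3 2 4) {i : Fin 4}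
    {m : List (ℤ × ℤ × ℤ)} (hm : m ∈ blockInt i) (u : ℤ × ℤ × ℤ) {j : ℕ} (hj : j < 8) :
    Subdivides C3 s(ofInt (vertex u m j), ofInt (vertex u m (j + 1)))
      s(ofInt (halfVertex u m 0), ofInt (halfVertex u m 8)) := by
  obtain ⟨c, hc, h0, h8, h⟩ := exists_curve_of_block hC3 hH hm u
  refine ⟨_, _, rfl, c, hc, ?_, ?_, h j hj⟩
  · rwa [two_smul_ofInt_halfVertex hm u (by simp)]
  · rwa [two_smul_ofInt_halfVertex hm u (by simp)]

theorem exists_block_of_isSeg (hC3 : traceOf C3 = CTrace) (hH : SatH C3 2 4) (hS : IsSeg S) :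
    ∃ u i, ∃ m ∈ blockInt i, ∃ j < 8,
      S = s(ofInt (vertex u m j), ofInt (vertex u m (j + 1))) :=
  mem_segs_CTrace.1 (hC3 ▸ hH.exists_mem_segs hS)

theorem mem_segs_pow_succ (hP : PowersOf C3 2 P) {s : ℕ} :
    S ∈ (traceOf (P (s + 1))).segs ↔ ∃ T ∈ (traceOf (P s)).segs, Subdivides C3 S T := by
  rw [hP.2.2 s]
  constructor
  · rintro ⟨a, b, hab, h⟩
    exact ⟨_, hab, a, b, rfl, h⟩
  · rintro ⟨_, hab, a, b, rfl, h⟩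
    exact ⟨a, b, hab, h⟩

theorem mem_segs_pow_iff (hC3 : traceOf C3 = CTrace) (hH : SatH C3 2 4)
    (hP : PowersOf C3 2 P) (s : ℕ) : S ∈ (traceOf (P s)).segs ↔ IsSeg S := by
  refine ⟨isSeg_of_mem_segs_traceOf, fun hS => ?_⟩
  induction s generalizing S with
  | zero => rw [hP.2.1]; exact hS
  | succ s ih =>
    obtain ⟨u, i, m, hm, j, hj, rfl⟩ := exists_block_of_isSeg hC3 hH hS
    exact (mem_segs_pow_succ hP).2
      ⟨_, ih (isSeg_halfVertex hm u), subdivides_of_block hC3 hH hm u hj⟩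

theorem conn_pow_succ (hP : PowersOf C3 2 P) (hC3 : traceOf C3 = CTrace) (hH : SatH C3 2 4)
    {s : ℕ} (h : (traceOf (P s)).conn S T) : (traceOf (P (s + 1))).conn S T := by
  induction s generalizing S T with
  | zero => rw [hP.2.1] at h; exact h.elim
  | succ s ih =>
    rw [hP.2.2 s] at h
    rw [hP.2.2 (s + 1)]
    rcases h with ⟨a, b, hab, h⟩ | ⟨a, b, d, hab, h⟩
    · refine Or.inl ⟨a, b, ?_, h⟩
      rw [mem_segs_pow_iff hC3 hH hP] at hab ⊢
      exact hab
    · exact Or.inr ⟨a, b, d, ih hab, h⟩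

theorem conn_pow_mono (hP : PowersOf C3 2 P) (hC3 : traceOf C3 = CTrace) (hH : SatH C3 2 4)
    {s t : ℕ} (hst : s ≤ t) (h : (traceOf (P s)).conn S T) : (traceOf (P t)).conn S T := by
  induction t, hst using Nat.le_induction with
  | base => exact h
  | succ t _ ih => exact conn_pow_succ hP hC3 hH ih

theorem noConnAt_zero_pow (hP : PowersOf C3 2 P) (hC3 : traceOf C3 = CTrace) (s : ℕ) :
    NoConnAt (traceOf (P s)) 0 := by
  induction s with
  | zero =>
    intro S T h
    rw [hP.2.1] at h
    exact h.elim
  | succ s ih =>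
    rintro S T h ⟨hS, hT⟩
    rw [hP.2.2 s] at h
    rcases h with ⟨a, b, hab, c, hc, -, -, h⟩ | ⟨a, b, d, hab, c, hc, c', hc', -, -, -, -, h⟩
    · have h0 := noConnAt_CTrace 0
      rw [smul_zero, ofInt_zero, ← hC3] at h0
      exact h0 S T ⟨c, hc, h⟩ ⟨hS, hT⟩
    · have hb : latt b := (isSeg_of_mem_segs_traceOf (mem_segs_of_conn_traceOf hab).1).latt_right
      have hb0 : b ≠ 0 := by
        rintro rfl
        exact ih _ _ hab (by simp)
      obtain ⟨S', hS', h0, hbS'⟩ : ∃ S', IsSeg S' ∧ 0 ∈ S' ∧ (2 : ℝ) • b ∈ S' := by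
        rcases h with ⟨h, -⟩ | ⟨h, -⟩
        · exact ⟨S, Curve.isSeg_of_mem_segs (Curve.mem_segs_of_endSegAt h), hS,
            Curve.mem_of_endSegAt h⟩
        · exact ⟨T, Curve.isSeg_of_mem_segs (Curve.mem_segs_of_endSegAt h), hT,
            Curve.mem_of_endSegAt h⟩
      have hne : (0 : Pt 3) ≠ (2 : ℝ) • b := (smul_ne_zero two_ne_zero hb0).symm
      rw [(Sym2.mem_and_mem_iff hne).1 ⟨h0, hbS'⟩] at hS'
      exact not_isSeg_zero_two_smul hb hS'

/-- The segment `S` belongs to a curve of `E` containing a segment at `0`. -/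
def Reach (E : Set (Curve 3)) (S : Sym2 (Pt 3)) : Prop :=
  ∃ u, IsSeg s(0, u) ∧ Relation.ReflTransGen (traceOf E).conn s(0, u) S

theorem Reach.exists_endpt_curve (hC3 : traceOf C3 = CTrace) (hH : SatH C3 2 4)
    (hP : PowersOf C3 2 P) {s : ℕ} (h : Reach (P s) S) :
    ∃ c ∈ P s, c.IsEndpt 0 ∧ S ∈ c.segs := by
  obtain ⟨u, hu, h⟩ := h
  obtain ⟨c, hc, huc⟩ := (mem_segs_pow_iff hC3 hH hP s).2 hu
  exact ⟨c, hc, (noConnAt_zero_pow hP hC3 s).isEndpt hc huc (by simp),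
    (hP.1 s).mem_segs_of_reflTransGen hc huc h⟩

theorem reach_of_zero_mem (E : Set (Curve 3)) (hS : IsSeg S) (h : 0 ∈ S) : Reach E S := by
  obtain ⟨u, -, rfl⟩ := isSeg_zero_left hS h
  exact ⟨u, hS, .refl⟩

theorem SatH.exists_curve_of_isSeg (hH : SatH C3 2 4) {a b : Pt 3} (h : IsSeg s(a, b)) :
    ∃ c ∈ C3, c.IsEndpt ((2 : ℝ) • a) ∧ c.IsEndpt ((2 : ℝ) • b) := by
  obtain ⟨x, i, hx, h⟩ := h
  have hx2 : latt ((2 : ℝ) • x) ∧ inLat 2 ((2 : ℝ) • x) := by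
    constructor
    · intro j
      obtain ⟨k, hk⟩ := hx j
      exact ⟨2 * k, by simp [hk]⟩
    · intro j
      obtain ⟨k, hk⟩ := hx j
      exact ⟨k, by simp [hk]⟩
  obtain ⟨c, hc, h1, h2⟩ := (hH.2.2.2.2.2.1 _ i hx2.1 hx2.2).1
  have h2' : c.IsEndpt ((2 : ℝ) • (x + uvec 3 i)) := by
    rw [smul_add]
    exact_mod_cast h2
  rcases Sym2.eq_iff.1 h with ⟨rfl, rfl⟩ | ⟨rfl, rfl⟩
  · exact ⟨c, hc, h1, h2'⟩
  · exact ⟨c, hc, h2', h1⟩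

theorem reflTransGen_pow_succ (hP : PowersOf C3 2 P) {s : ℕ} {a b : Pt 3}
    (hab : s(a, b) ∈ (traceOf (P s)).segs) {c : Curve 3} (hc : c ∈ C3)
    (ha : c.IsEndpt ((2 : ℝ) • a)) (hb : c.IsEndpt ((2 : ℝ) • b)) (hS : S ∈ c.segs)
    (hT : T ∈ c.segs) : Relation.ReflTransGen (traceOf (P (s + 1))).conn S T := by
  refine Relation.ReflTransGen.mono (fun A B hAB => ?_) _ _ (Curve.reflTransGen_conn hS hT)
  rw [hP.2.2 s]
  exact Or.inl ⟨a, b, hab, c, hc, ha, hb, hAB⟩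

theorem Reach.succ (hC3 : traceOf C3 = CTrace) (hH : SatH C3 2 4)
    (hP : PowersOf C3 2 P) {s : ℕ} (h : Reach (P s) T) (hST : Subdivides C3 S T) :
    Reach (P (s + 1)) S := by
  obtain ⟨u, hu, h⟩ := h
  induction h generalizing S with
  | refl =>
    obtain ⟨a, b, hab, c, hc, ha, hb, hS⟩ := hST
    have h0 : c.IsEndpt 0 := by
      rcases Sym2.eq_iff.1 hab with ⟨rfl, -⟩ | ⟨rfl, -⟩
      · simpa using ha
      · simpa using hb
    obtain ⟨S₀, hS₀⟩ := Curve.exists_endSegAt h0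
    have hS₀c := Curve.mem_segs_of_endSegAt hS₀
    obtain ⟨w, -, rfl⟩ :=
      isSeg_zero_left (Curve.isSeg_of_mem_segs hS₀c) (Curve.mem_of_endSegAt hS₀)
    rw [hab, ← mem_segs_pow_iff hC3 hH hP s] at hu
    exact ⟨w, Curve.isSeg_of_mem_segs hS₀c, reflTransGen_pow_succ hP hu hc ha hb hS₀c hS⟩
  | @tail T' T _ hconn ih =>
    obtain ⟨e, he, hconn'⟩ := hconn
    obtain ⟨a, b, d, rfl, rfl, hab, hbd⟩ := Curve.exists_of_conn hconn'
    obtain ⟨c', hc', ha', hb'⟩ := hH.exists_curve_of_isSeg (Curve.isSeg_of_mem_segs hab)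
    obtain ⟨c, hc, hb, hd, hS⟩ : ∃ c ∈ C3, c.IsEndpt ((2 : ℝ) • b) ∧
        c.IsEndpt ((2 : ℝ) • d) ∧ S ∈ c.segs := by
      obtain ⟨x, y, hxy, c, hc, hx, hy, hS⟩ := hST
      rcases Sym2.eq_iff.1 hxy with ⟨rfl, rfl⟩ | ⟨rfl, rfl⟩
      · exact ⟨c, hc, hx, hy, hS⟩
      · exact ⟨c, hc, hy, hx, hS⟩
    obtain ⟨A', hA'⟩ := Curve.exists_endSegAt hb'
    obtain ⟨A, hA⟩ := Curve.exists_endSegAt hb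
    obtain ⟨w, hw, hwA'⟩ := ih ⟨a, b, rfl, c', hc', ha', hb', Curve.mem_segs_of_endSegAt hA'⟩
    refine ⟨w, hw, (hwA'.tail ?_).trans (reflTransGen_pow_succ hP ⟨e, he, hbd⟩ hc hb hd
      (Curve.mem_segs_of_endSegAt hA) hS)⟩
    rw [hP.2.2 s]
    exact Or.inr ⟨a, b, d, ⟨e, he, hconn'⟩, c', hc', c, hc, ha', hb', hb, hd, Or.inl ⟨hA', hA⟩⟩

theorem reach_of_reaches (hC3 : traceOf C3 = CTrace) (hH : SatH C3 2 4)
    (hP : PowersOf C3 2 P) {s : ℕ} {a b : ℤ × ℤ × ℤ} (hab : IsSeg s(ofInt a, ofInt b))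
    (h : reaches s a b = true) : Reach (P s) s(ofInt a, ofInt b) := by
  induction s generalizing a b with
  | zero =>
    refine reach_of_zero_mem _ hab ?_
    rw [← ofInt_zero]
    rcases (by simpa [reaches] using h : a = 0 ∨ b = 0) with rfl | rfl <;> simp
  | succ s ih =>
    simp only [reaches, List.any_eq_true, List.mem_finRange, true_and, List.mem_range,
      Bool.or_eq_true, Bool.and_eq_true, decide_eq_true_eq] at h
    have key : ∀ (i : Fin 4) (m : List (ℤ × ℤ × ℤ)), m ∈ blockInt i → ∀ j < 8,
        ∀ u a b : ℤ × ℤ × ℤ, vertex u m j = a → vertex u m (j + 1) = b →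
        reaches s (halfVertex u m 0) (halfVertex u m 8) = true →
        Reach (P (s + 1)) s(ofInt a, ofInt b) := by
      rintro i m hm j hj u _ _ rfl rfl h
      exact (ih (isSeg_halfVertex hm u) h).succ hC3 hH hP (subdivides_of_block hC3 hH hm u hj)
    obtain ⟨i, m, hm, j, hj, ⟨⟨h1, h2⟩, h⟩ | ⟨⟨h1, h2⟩, h⟩⟩ := h
    · exact key i m hm j hj _ a b h1 h2 h
    · rw [Sym2.eq_swap]
      exact key i m hm j hj _ b a h1 h2 h

theorem reach_of_near (hC3 : traceOf C3 = CTrace) (hH : SatH C3 2 4) (hP : PowersOf C3 2 P)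
    (s : ℕ) {a b : ℤ × ℤ × ℤ} (hab : IsSeg s(ofInt a, ofInt b)) (hn : Near (2 ^ s) a b) :
    Reach (P (s + 3)) s(ofInt a, ofInt b) := by
  induction s generalizing a b with
  | zero =>
    have key : ∀ (a : ℤ × ℤ × ℤ) (k : Fin 3), Near 1 a (a + basisInt k) →
        reaches 3 a (a + basisInt k) = true := by
      rintro ⟨x, y, z⟩ k hn
      have hk : ∀ k : Fin 3, (0 ≤ (basisInt k).1 ∧ (basisInt k).1 ≤ 1) ∧
          (0 ≤ (basisInt k).2.1 ∧ (basisInt k).2.1 ≤ 1) ∧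
          (0 ≤ (basisInt k).2.2 ∧ (basisInt k).2.2 ≤ 1) := by decide
      have aux : ∀ x e : ℤ, (0 ≤ e ∧ e ≤ 1) → (-1 ≤ max x (x + e) ∧ min x (x + e) ≤ 1) →
          x ∈ [-2, -1, 0, 1] := by
        intro x e he hx
        have : x = -2 ∨ x = -1 ∨ x = 0 ∨ x = 1 := by lia
        simpa using this
      obtain ⟨k1, k2, k3⟩ := hk k
      exact reaches_three_of_near_one x (aux _ _ k1 hn.1) y (aux _ _ k2 hn.2.1) z
        (aux _ _ k3 hn.2.2) k hn
    rw [pow_zero] at hn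
    obtain ⟨x, k, h⟩ := exists_ofInt_of_isSeg hab
    rw [h]
    rw [h] at hab
    refine reach_of_reaches hC3 hH hP hab (key x k ?_)
    rcases Sym2.eq_iff.1 h with ⟨h1, h2⟩ | ⟨h1, h2⟩
    · rwa [ofInt_injective h1, ofInt_injective h2] at hn
    · rw [ofInt_injective h1, ofInt_injective h2] at hn
      exact hn.symm
  | succ s ih =>
    obtain ⟨u, i, m, hm, j, hj, h⟩ := exists_block_of_isSeg hC3 hH hab
    rw [h]
    have hn' : Near (2 * 2 ^ s) (vertex u m j) (vertex u m (j + 1)) := by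
      rw [← pow_succ']
      rcases Sym2.eq_iff.1 h with ⟨h1, h2⟩ | ⟨h1, h2⟩
      · rwa [← ofInt_injective h1, ← ofInt_injective h2]
      · rw [← ofInt_injective h1, ← ofInt_injective h2]
        exact hn.symm
    exact (ih (isSeg_halfVertex hm u) (near_halfVertex hm hj hn')).succ hC3 hH hP
      (subdivides_of_block hC3 hH hm u hj)

theorem near_of_touches_cube {a b : ℤ × ℤ × ℤ} {h : ℕ}
    (ht : (segPts s(ofInt a, ofInt b) ∩ cube (0 : Pt 3) h).Nonempty) : Near h a b := by
  obtain ⟨p, ⟨x, y, hxy, t, ht0, ht1, rfl⟩, hp⟩ := ht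
  have aux : ∀ (h c d : ℤ) (t : ℝ), 0 ≤ t → t ≤ 1 → -(h : ℝ) ≤ c + t * (d - c) →
      c + t * (d - c) ≤ h → -h ≤ max c d ∧ min c d ≤ h := by
    intro h c d t ht0 ht1 h1 h2
    constructor
    · by_contra! hlt
      obtain ⟨hc, hd⟩ := max_lt_iff.1 hlt
      have hc' : (c : ℝ) ≤ -h - 1 := by exact_mod_cast Int.le_sub_one_of_lt hc
      have hd' : (d : ℝ) ≤ -h - 1 := by exact_mod_cast Int.le_sub_one_of_lt hd
      nlinarith [mul_nonneg ht0 (sub_nonneg.2 hd'),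
        mul_nonneg (sub_nonneg.2 ht1) (sub_nonneg.2 hc')]
    · by_contra! hlt
      obtain ⟨hc, hd⟩ := lt_min_iff.1 hlt
      have hc' : (h : ℝ) + 1 ≤ c := by exact_mod_cast hc
      have hd' : (h : ℝ) + 1 ≤ d := by exact_mod_cast hd
      nlinarith [mul_nonneg ht0 (sub_nonneg.2 hd'),
        mul_nonneg (sub_nonneg.2 ht1) (sub_nonneg.2 hc')]
  have key : ∀ a b : ℤ × ℤ × ℤ,
      ofInt a + t • (ofInt b - ofInt a) ∈ cube (0 : Pt 3) h → Near h a b := by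
    intro a b hp
    have h0 := hp 0
    have h1 := hp 1
    have h2 := hp 2
    simp only [PiLp.zero_apply, zero_sub, zero_add, PiLp.add_apply, PiLp.smul_apply,
      PiLp.sub_apply, smul_eq_mul, ofInt_apply_zero, ofInt_apply_one, ofInt_apply_two]
      at h0 h1 h2
    exact ⟨aux h _ _ t ht0 ht1 (by exact_mod_cast h0.1) (by exact_mod_cast h0.2),
      aux h _ _ t ht0 ht1 (by exact_mod_cast h1.1) (by exact_mod_cast h1.2),
      aux h _ _ t ht0 ht1 (by exact_mod_cast h2.1) (by exact_mod_cast h2.2)⟩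
  rcases Sym2.eq_iff.1 hxy with ⟨rfl, rfl⟩ | ⟨rfl, rfl⟩
  · exact key _ _ hp
  · exact (key _ _ hp).symm

theorem exists_reach (hC3 : traceOf C3 = CTrace) (hH : SatH C3 2 4) (hP : PowersOf C3 2 P)
    (hS : IsSeg S) : ∃ s, ∀ t, s ≤ t → Reach (P t) S := by
  obtain ⟨a, k, rfl⟩ := exists_ofInt_of_isSeg hS
  obtain ⟨N, hN⟩ : ∃ N : ℕ, Near N a (a + basisInt k) := by
    refine ⟨(|a.1| + |a.2.1| + |a.2.2|).toNat, ?_⟩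
    have hk : ∀ k : Fin 3, 0 ≤ (basisInt k).1 ∧ 0 ≤ (basisInt k).2.1 ∧ 0 ≤ (basisInt k).2.2 := by
      decide
    obtain ⟨k1, k2, k3⟩ := hk k
    unfold Near
    simp only [Prod.fst_add, Prod.snd_add]
    grind
  refine ⟨N + 3, fun t ht => ?_⟩
  obtain ⟨r, rfl⟩ := Nat.exists_eq_add_of_le' (show 3 ≤ t by lia)
  refine reach_of_near hC3 hH hP r hS ?_
  have hle : (N : ℤ) ≤ 2 ^ r := by
    have : N < 2 ^ r := (show N ≤ r by lia).trans_lt Nat.lt_two_pow_self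
    exact_mod_cast this.le
  obtain ⟨⟨h1, h2⟩, ⟨h3, h4⟩, h5, h6⟩ := hN
  exact ⟨⟨(neg_le_neg hle).trans h1, h2.trans hle⟩, ⟨(neg_le_neg hle).trans h3, h4.trans hle⟩,
    (neg_le_neg hle).trans h5, h6.trans hle⟩

/-- The inductive limit of the curves of the powers of `C3` starting along `[0, u]`. -/
theorem exists_hat_curve (hC3 : traceOf C3 = CTrace) (hH : SatH C3 2 4) (hP : PowersOf C3 2 P)
    {u : Pt 3} (hu : IsDir u) : ∃ d : Curve 3, d.IsEndpt 0 ∧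
      (∀ S, S ∈ d.segs ↔ ∃ s, ∃ c ∈ P s, s(0, u) ∈ c.segs ∧ S ∈ c.segs) ∧
      ∀ S T, d.conn S T ↔ ∃ s, ∃ c ∈ P s, s(0, u) ∈ c.segs ∧ c.conn S T := by
  have hex : ∀ s, ∃ c ∈ P s, ∃ d, SameCurve d c ∧ StartsAlong u d := by
    intro s
    obtain ⟨c, hc, huc⟩ := (mem_segs_pow_iff hC3 hH hP s).2 (isSeg_zero_isDir hu)
    exact ⟨c, hc, exists_startsAlong ((hP.1 s).1 c hc) huc fun S T h =>
      noConnAt_zero_pow hP hC3 s S T ⟨c, hc, h⟩⟩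
  choose c hc d hdc hd using hex
  have huc : ∀ s, s(0, u) ∈ (c s).segs := fun s => (hdc s).1 ▸ (hd s).mem_segs
  have hsub : ∀ s t, s ≤ t → SubCurve (d s) (d t) := by
    intro s t hst
    have hsegs : (c s).segs ⊆ (c t).segs := by
      intro S hS
      refine (hP.1 t).mem_segs_of_reflTransGen (hc t) (huc t) ?_
      exact Relation.ReflTransGen.mono
        (fun A B hAB => conn_pow_mono hP hC3 hH hst ⟨_, hc s, hAB⟩) _ _
        (Curve.reflTransGen_conn (huc s) hS)
    rw [SubCurve, (hdc s).1, (hdc s).2, (hdc t).1, (hdc t).2]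
    exact ⟨hsegs, fun S T h => (hP.1 t).conn_of_conn (hc t)
      (hsegs (Curve.left_mem_segs_of_conn h)) (conn_pow_mono hP hC3 hH hst ⟨_, hc s, h⟩)⟩
  obtain ⟨e, hdom, hv, hsegs, hconn⟩ := exists_limit_curve d fun s t hst i hi =>
    (hd s).subCurve_prefix (hd t) (hsub s t hst) hi
  refine ⟨e, ⟨0, (hdom 0).2 ⟨0, (hd 0).zero_mem⟩, ?_, Or.inl ?_⟩, fun S => ?_, fun S T => ?_⟩
  · rw [hv 0 0 (hd 0).zero_mem, (hd 0).v_zero]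
  · rw [hdom]
    rintro ⟨s, hs⟩
    exact (hd s).neg_one_notMem hs
  · rw [hsegs]
    constructor
    · rintro ⟨s, hs⟩
      exact ⟨s, c s, hc s, huc s, (hdc s).1 ▸ hs⟩
    · rintro ⟨s, c', hc', huc', hS⟩
      refine ⟨s, ?_⟩
      rwa [(hdc s).1, ((hP.1 s).sameCurve (hc s) hc' (huc s) huc').1]
  · rw [hconn]
    constructor
    · rintro ⟨s, hs⟩
      exact ⟨s, c s, hc s, huc s, (hdc s).2 ▸ hs⟩
    · rintro ⟨s, c', hc', huc', hS⟩
      refine ⟨s, ?_⟩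
      rwa [(hdc s).2, ((hP.1 s).sameCurve (hc s) hc' (huc s) huc').2]

end Powers

/-- Proposition 2.4: for each integer `s ≥ 4`, `𝒟ₛ` covers
`P_{0,2^{s-3}}`.  In particular, `Ĉ` is the union of `6` curves with endpoint `0`. -/
theorem statement11 (C3 : Set (Curve 3)) (hC3 : traceOf C3 = CTrace)
    (hH : SatH C3 2 4) (P : ℕ → Set (Curve 3)) (hP : PowersOf C3 2 P) :
    (∀ s : ℕ, 4 ≤ s →
      Covers {c | c ∈ P s ∧ c.IsEndpt 0} (cube (0 : Pt 3) (2 ^ (s - 3)))) ∧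
    ∃ L : List (Curve 3), L.length = 6 ∧ (∀ c ∈ L, c.IsEndpt 0) ∧
      traceOf {c | c ∈ L} = hatTrace P := by
  refine ⟨fun s hs S hS ht => ⟨?_, ?_⟩, ?_⟩
  · obtain ⟨r, rfl⟩ := Nat.exists_eq_add_of_le' (show 3 ≤ s by lia)
    obtain ⟨a, k, rfl⟩ := exists_ofInt_of_isSeg hS
    have hn := near_of_touches_cube ht
    rw [Nat.add_sub_cancel] at hn
    obtain ⟨c, hc, h0, hSc⟩ :=
      (reach_of_near hC3 hH hP r hS (by exact_mod_cast hn)).exists_endpt_curve hC3 hH hP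
    exact ⟨c, ⟨hc, h0⟩, hSc⟩
  · exact fun c hc d hd hSc hSd => (hP.1 s).sameCurve hc.1 hd.1 hSc hSd
  · choose f hf0 hfsegs hfconn using fun u : {u : Pt 3 // IsDir u} =>
      exists_hat_curve hC3 hH hP u.2
    let dir : Fin 3 × Bool → {u : Pt 3 // IsDir u} := fun x =>
      if x.2 then ⟨uvec 3 x.1, x.1, Or.inl rfl⟩ else ⟨-uvec 3 x.1, x.1, Or.inr rfl⟩
    have hdir : ∀ u, ∃ x, dir x = u := by
      rintro ⟨u, i, rfl | rfl⟩
      · exact ⟨(i, true), rfl⟩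
      · exact ⟨(i, false), rfl⟩
    let L : List (Curve 3) :=
      ((List.finRange 3).product [true, false]).map fun x => f (dir x)
    have hL : ∀ c, c ∈ L ↔ ∃ u, f u = c := by
      intro c
      simp only [L, List.mem_map]
      constructor
      · rintro ⟨x, -, rfl⟩
        exact ⟨_, rfl⟩
      · rintro ⟨u, rfl⟩
        obtain ⟨⟨i, b⟩, rfl⟩ := hdir u
        exact ⟨(i, b), by cases b <;> simp [List.pair_mem_product], rfl⟩
    have hreach : ∀ S, IsSeg S → ∃ s, ∀ t, s ≤ t →
        ∃ u : {u : Pt 3 // IsDir u}, ∃ c ∈ P t, s(0, u.1) ∈ c.segs ∧ S ∈ c.segs := by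
      intro S hS
      obtain ⟨s, hs⟩ := exists_reach hC3 hH hP hS
      refine ⟨s, fun t ht => ?_⟩
      obtain ⟨w, hw, h⟩ := hs t ht
      obtain ⟨c, hc, hwc⟩ := (mem_segs_pow_iff hC3 hH hP t).2 hw
      obtain ⟨u, hu, huw⟩ := isSeg_zero_left hw (by simp)
      exact ⟨⟨u, hu⟩, c, hc, huw ▸ hwc, (hP.1 t).mem_segs_of_reflTransGen hc hwc h⟩
    refine ⟨L, by rw [List.length_map]; rfl, fun c hc => ?_, ?_⟩
    · obtain ⟨u, rfl⟩ := (hL c).1 hc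
      exact hf0 u
    · have hsegs : (traceOf {c | c ∈ L}).segs = (hatTrace P).segs := by
        ext S
        constructor
        · rintro ⟨c, hc, hS⟩
          obtain ⟨u, rfl⟩ := (hL c).1 hc
          obtain ⟨s, c, hc, -, hSc⟩ := (hfsegs u S).1 hS
          exact ⟨s, c, hc, hSc⟩
        · rintro ⟨s, hS⟩
          obtain ⟨t, ht⟩ := hreach S (isSeg_of_mem_segs_traceOf hS)
          obtain ⟨u, c, hc, huc, hSc⟩ := ht t le_rfl
          exact ⟨f u, (hL _).2 ⟨u, rfl⟩, (hfsegs u S).2 ⟨t, c, hc, huc, hSc⟩⟩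
      have hconn : (traceOf {c | c ∈ L}).conn = (hatTrace P).conn := by
        ext S T
        constructor
        · rintro ⟨c, hc, hST⟩
          obtain ⟨u, rfl⟩ := (hL c).1 hc
          obtain ⟨s, c, hc, -, hc'⟩ := (hfconn u S T).1 hST
          exact ⟨s, c, hc, hc'⟩
        · rintro ⟨s, hST⟩
          obtain ⟨t, ht⟩ := hreach S (isSeg_of_mem_segs_traceOf (mem_segs_of_conn_traceOf hST).1)
          obtain ⟨u, c, hc, huc, hSc⟩ := ht (max s t) (le_max_right _ _)
          exact ⟨f u, (hL _).2 ⟨u, rfl⟩, (hfconn u S T).2 ⟨max s t, c, hc, huc,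
            (hP.1 _).conn_of_conn hc hSc (conn_pow_mono hP hC3 hH (le_max_left _ _) hST)⟩⟩
      exact congrArg₂ Trace.mk hsegs hconn

end
end Folding
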